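/- arXiv:1502.00693 — 2 statements merged into one kernel-verified Lean document; each statement's English description precedes it below -/
import Mathlib

section
/- Let P be a hexagonal typical 6-configuration with consecutive cyclic labeling p₁,…,p₆ (indices modulo 6). A permutation σ of {1,…,6} is realized by a Q-deformation loop at P — i.e., there is a Q-deformation γ₁,…,γ₆ with γ_i(0) = p_i and γ_i(1) = p_{σ(i)} for all i — if and only if σ is a symmetry of the cyclic order (a rotation i ↦ i + k mod 6 or a reflection i ↦ c − i mod 6) that maps dominant points of P to dominant points. In particular, the permutations so realized form a group isomorphic to the dihedral group D₃ of order 6. -/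
open scoped LinearAlgebra.Projectivization
open Projectivization

noncomputable section

/-- The real projective plane: the projectivization of `ℝ³`. -/
abbrev RP2 := ℙ ℝ (Fin 3 → ℝ)

/-- The quotient topology on the real projective plane. -/
instance : TopologicalSpace RP2 :=
  inferInstanceAs (TopologicalSpace (Quotient (projectivizationSetoid ℝ (Fin 3 → ℝ))))

/-- Three points of `ℙ²(ℝ)` are collinear if they admit linearly dependent representatives. -/
def Collin (a b c : RP2) : Prop :=
  ¬ LinearIndependent ℝ ![a.rep, b.rep, c.rep]

/-- The conic (zero set in `ℙ²(ℝ)`) associated to a quadratic form on `ℝ³`. -/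
def ConicSet (q : QuadraticForm ℝ (Fin 3 → ℝ)) : Set RP2 := {p : RP2 | q p.rep = 0}

/-- A set of points is coconic if some conic contains all of them. -/
def Coconic (s : Set RP2) : Prop :=
  ∃ q : QuadraticForm ℝ (Fin 3 → ℝ), q ≠ 0 ∧ ∀ p ∈ s, q p.rep = 0

/-- A labeled `n`-configuration is simple if it is injective and has no collinear triple. -/
def SimpleCfg {n : ℕ} (f : Fin n → RP2) : Prop :=
  Function.Injective f ∧
    ∀ i j k : Fin n, i ≠ j → i ≠ k → j ≠ k → ¬ Collin (f i) (f j) (f k)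

/-- A labeled `n`-configuration is typical if it is simple and no six of its points are coconic. -/
def TypicalCfg {n : ℕ} (f : Fin n → RP2) : Prop :=
  SimpleCfg f ∧ ∀ g : Fin 6 → Fin n, Function.Injective g → ¬ Coconic (Set.range (f ∘ g))

/-- A projective line: the set of points whose representatives lie in a 2-dimensional
subspace of `ℝ³`. -/
def IsProjLine (L : Set RP2) : Prop :=
  ∃ W : Submodule ℝ (Fin 3 → ℝ), Module.finrank ℝ W = 2 ∧ L = {p : RP2 | p.rep ∈ W}

/-- `p` lies inside the conic of `q` if every projective line through `p` meets the conic. -/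
def InsideConic (q : QuadraticForm ℝ (Fin 3 → ℝ)) (p : RP2) : Prop :=
  ∀ L : Set RP2, IsProjLine L → p ∈ L → (L ∩ ConicSet q).Nonempty

/-- `p` lies outside the conic of `q` if some projective line through `p` misses the conic. -/
def OutsideConic (q : QuadraticForm ℝ (Fin 3 → ℝ)) (p : RP2) : Prop :=
  ∃ L : Set RP2, IsProjLine L ∧ p ∈ L ∧ L ∩ ConicSet q = ∅

/-- A point `f i` of a configuration is dominant if it lies outside every conic passing
through all the other points of the configuration. -/
def Dominant {n : ℕ} (f : Fin n → RP2) (i : Fin n) : Prop :=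
  ∀ q : QuadraticForm ℝ (Fin 3 → ℝ), q ≠ 0 → (∀ j, j ≠ i → q ((f j).rep) = 0) →
    OutsideConic q (f i)

/-- A point `f i` of a configuration is subdominant if it lies inside every conic passing
through all the other points of the configuration. -/
def Subdominant {n : ℕ} (f : Fin n → RP2) (i : Fin n) : Prop :=
  ∀ q : QuadraticForm ℝ (Fin 3 → ℝ), q ≠ 0 → (∀ j, j ≠ i → q ((f j).rep) = 0) →
    InsideConic q (f i)

/-- The affine chart determined by a nonzero linear functional `φ` (with `L∞ = {φ = 0}`):
a point off `L∞` is sent to its representative rescaled to lie on the affine plane `φ = 1`. -/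
def chart (φ : (Fin 3 → ℝ) →ₗ[ℝ] ℝ) (p : RP2) : Fin 3 → ℝ := (φ p.rep)⁻¹ • p.rep

/-- Convex position with respect to the affine chart of `φ`: the line `{φ = 0}` misses the
configuration, and in the chart every point lies outside the convex hull of the others. -/
def ConvexPosWith {n : ℕ} (φ : (Fin 3 → ℝ) →ₗ[ℝ] ℝ) (f : Fin n → RP2) : Prop :=
  φ ≠ 0 ∧ (∀ i, φ (f i).rep ≠ 0) ∧
    ∀ i, chart φ (f i) ∉ convexHull ℝ (chart φ '' (f '' {j | j ≠ i}))

/-- A configuration is in convex position if it is so in some affine chart. -/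
def ConvexPos {n : ℕ} (f : Fin n → RP2) : Prop := ∃ φ, ConvexPosWith φ f

/-- The labeling of a configuration is consecutive for the convex position in the chart of `φ`:
each pair `f i`, `f (i+1)` (cyclically) spans an edge of the convex polygon, i.e. is cut out by
an affine functional which is strictly larger on both of them than on all the other points. -/
def ConsecWith {n : ℕ} [NeZero n] (φ : (Fin 3 → ℝ) →ₗ[ℝ] ℝ) (f : Fin n → RP2) : Prop :=
  ConvexPosWith φ f ∧
    ∀ i : Fin n, ∃ ψ : (Fin 3 → ℝ) →ₗ[ℝ] ℝ,
      ψ (chart φ (f i)) = ψ (chart φ (f (i + 1))) ∧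
      ∀ j : Fin n, j ≠ i → j ≠ i + 1 → ψ (chart φ (f j)) < ψ (chart φ (f i))

/-- A configuration is in convex position with consecutive cyclic labeling. -/
def ConsecConvexPos {n : ℕ} [NeZero n] (f : Fin n → RP2) : Prop := ∃ φ, ConsecWith φ f

/-- A Q-deformation (an `n`-tuple of continuous paths through typical configurations). -/
def QDeformFam (n : ℕ) (γ : Fin n → unitInterval → RP2) : Prop :=
  (∀ i, Continuous (γ i)) ∧ ∀ t : unitInterval, TypicalCfg (fun i => γ i t)

end
noncomputable section

/-- A permutation `σ` is realized by a Q-deformation loop at the configuration `f`. -/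
def RealizedPerm (f : Fin 6 → RP2) (σ : Equiv.Perm (Fin 6)) : Prop :=
  ∃ γ : Fin 6 → unitInterval → RP2, QDeformFam 6 γ ∧
    (∀ i, γ i 0 = f i) ∧ (∀ i, γ i 1 = f (σ i))

theorem joinedIn_det_mul {A B C D : Matrix (Fin 3) (Fin 3) ℝ}
    (h : JoinedIn {M : Matrix (Fin 3) (Fin 3) ℝ | 0 < M.det} A B)
    (h' : JoinedIn {M : Matrix (Fin 3) (Fin 3) ℝ | 0 < M.det} C D) :
    JoinedIn {M : Matrix (Fin 3) (Fin 3) ℝ | 0 < M.det} (A * C) (B * D) := by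
  refine (h.mul h').mono ?_
  rintro _ ⟨M, hM, N, hN, rfl⟩
  simp only [Set.mem_ofPred_eq, Matrix.det_mul] at *
  exact mul_pos hM hN

theorem joinedIn_det_transvections (L : List (Matrix.TransvectionStruct (Fin 3) ℝ)) :
    JoinedIn {M : Matrix (Fin 3) (Fin 3) ℝ | 0 < M.det} 1
      (L.map Matrix.TransvectionStruct.toMatrix).prod := by
  induction L with
  | nil => exact JoinedIn.refl (by simp)
  | cons s L ih =>
    rw [List.map_cons, List.prod_cons, ← one_mul (1 : Matrix (Fin 3) (Fin 3) ℝ)]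
    refine joinedIn_det_mul ?_ ih
    refine JoinedIn.ofLine (f := fun t : ℝ => Matrix.transvection s.i s.j (t * s.c)) ?_ ?_ ?_ ?_
    · unfold Matrix.transvection
      refine Continuous.continuousOn (continuous_const.add ?_)
      refine continuous_matrix fun i j => ?_
      simp only [Matrix.single, Matrix.of_apply]
      split_ifs <;> fun_prop
    · simp
    · simp [Matrix.TransvectionStruct.toMatrix]
    · rintro _ ⟨t, _, rfl⟩
      simp [Matrix.det_transvection_of_ne _ _ s.hij]

theorem joinedIn_det_diagonal_of_pos {D : Fin 3 → ℝ} (hD : ∀ i, 0 < D i) :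
    JoinedIn {M : Matrix (Fin 3) (Fin 3) ℝ | 0 < M.det} 1 (Matrix.diagonal D) := by
  refine JoinedIn.ofLine (f := fun t : ℝ => Matrix.diagonal fun i => 1 - t + t * D i) ?_ ?_ ?_ ?_
  · exact Continuous.continuousOn (by fun_prop)
  · simp
  · simp
  · rintro _ ⟨t, ⟨h0, h1⟩, rfl⟩
    simp only [Set.mem_ofPred_eq, Matrix.det_diagonal]
    refine Finset.prod_pos fun i _ => ?_
    rcases h0.eq_or_lt with rfl | h0
    · simp
    · nlinarith [mul_pos h0 (hD i)]

theorem joinedIn_det_of_trig {f : ℝ → ℝ → Matrix (Fin 3) (Fin 3) ℝ}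
    (hf : Continuous fun x : ℝ × ℝ => f x.1 x.2) (h1 : f 1 0 = 1)
    (hdet : ∀ c s, (f c s).det = c ^ 2 + s ^ 2) :
    JoinedIn {M : Matrix (Fin 3) (Fin 3) ℝ | 0 < M.det} 1 (f (-1) 0) := by
  refine JoinedIn.ofLine
    (f := fun t : ℝ => f (Real.cos (Real.pi * t)) (Real.sin (Real.pi * t))) ?_ ?_ ?_ ?_
  · exact (hf.comp (by fun_prop :
      Continuous fun t : ℝ => (Real.cos (Real.pi * t), Real.sin (Real.pi * t)))).continuousOn
  · simp [h1]
  · simp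
  · rintro _ ⟨t, _, rfl⟩
    simp [hdet]

theorem joinedIn_det_diagonal {D : Fin 3 → ℝ} (hD : 0 < D 0 * D 1 * D 2) :
    JoinedIn {M : Matrix (Fin 3) (Fin 3) ℝ | 0 < M.det} 1 (Matrix.diagonal D) := by
  have key : ∀ (f : ℝ → ℝ → Matrix (Fin 3) (Fin 3) ℝ) (E : Fin 3 → ℝ),
      (Continuous fun x : ℝ × ℝ => f x.1 x.2) → f 1 0 = 1 →
      (∀ c s, (f c s).det = c ^ 2 + s ^ 2) → (∀ i, 0 < E i * D i) →
      f (-1) 0 = Matrix.diagonal E → (∀ i, E i * E i = 1) →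
      JoinedIn {M : Matrix (Fin 3) (Fin 3) ℝ | 0 < M.det} 1 (Matrix.diagonal D) := by
    intro f E hf h1 hdet hpos hE hEE
    have := joinedIn_det_mul (joinedIn_det_of_trig hf h1 hdet) (joinedIn_det_diagonal_of_pos hpos)
    rw [one_mul, hE, Matrix.diagonal_mul_diagonal] at this
    have e : (fun i => E i * (E i * D i)) = D :=
      funext fun i => by rw [← mul_assoc, hEE, one_mul]
    rwa [e] at this
  have h0 : D 0 ≠ 0 := by rintro h; simp [h] at hD
  have h1 : D 1 ≠ 0 := by rintro h; simp [h] at hD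
  have h2 : D 2 ≠ 0 := by rintro h; simp [h] at hD
  rcases h0.lt_or_gt with h0 | h0 <;> rcases h1.lt_or_gt with h1 | h1 <;>
    rcases h2.lt_or_gt with h2 | h2
  · nlinarith [mul_pos_of_neg_of_neg h0 h1]
  · refine key (fun c s => !![c, -s, 0; s, c, 0; 0, 0, 1]) ![-1, -1, 1] ?_ ?_ ?_ ?_ ?_ ?_
    · refine continuous_matrix fun i j => ?_
      fin_cases i <;> fin_cases j <;> simp <;> fun_prop
    · ext i j; fin_cases i <;> fin_cases j <;> simp
    · intro c s; simp [Matrix.det_fin_three]; ring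
    · intro i; fin_cases i <;> simp [*]
    · ext i j; fin_cases i <;> fin_cases j <;> simp
    · intro i; fin_cases i <;> simp
  · refine key (fun c s => !![c, 0, -s; 0, 1, 0; s, 0, c]) ![-1, 1, -1] ?_ ?_ ?_ ?_ ?_ ?_
    · refine continuous_matrix fun i j => ?_
      fin_cases i <;> fin_cases j <;> simp <;> fun_prop
    · ext i j; fin_cases i <;> fin_cases j <;> simp
    · intro c s; simp [Matrix.det_fin_three]; ring
    · intro i; fin_cases i <;> simp [*]
    · ext i j; fin_cases i <;> fin_cases j <;> simp
    · intro i; fin_cases i <;> simp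
  · nlinarith [mul_pos h1 h2]
  · refine key (fun c s => !![1, 0, 0; 0, c, -s; 0, s, c]) ![1, -1, -1] ?_ ?_ ?_ ?_ ?_ ?_
    · refine continuous_matrix fun i j => ?_
      fin_cases i <;> fin_cases j <;> simp <;> fun_prop
    · ext i j; fin_cases i <;> fin_cases j <;> simp
    · intro c s; simp [Matrix.det_fin_three]; ring
    · intro i; fin_cases i <;> simp [*]
    · ext i j; fin_cases i <;> fin_cases j <;> simp
    · intro i; fin_cases i <;> simp
  · nlinarith [mul_pos h0 h2]
  · nlinarith [mul_pos h0 h1]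
  · exact joinedIn_det_diagonal_of_pos fun i => by fin_cases i <;> assumption

/-- The group `GL₃⁺(ℝ)` is path connected. -/
theorem isPathConnected_det_pos :
    IsPathConnected {M : Matrix (Fin 3) (Fin 3) ℝ | 0 < M.det} := by
  refine ⟨1, by simp, fun {M} hM => ?_⟩
  obtain ⟨L, L', D, rfl⟩ := Matrix.Pivot.exists_list_transvec_mul_diagonal_mul_list_transvec M
  rw [Set.mem_ofPred_eq] at hM
  simp only [Matrix.det_mul, Matrix.TransvectionStruct.det_toMatrix_prod, one_mul, mul_one,
    Matrix.det_diagonal, Fin.prod_univ_three] at hM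
  have := joinedIn_det_mul (joinedIn_det_mul (joinedIn_det_transvections L)
    (joinedIn_det_diagonal hM)) (joinedIn_det_transvections L')
  simpa using this

/-- The bracket `[u v w]`, the determinant of three vectors of `ℝ³`. -/
def bracket (u v w : Fin 3 → ℝ) : ℝ :=
  u 0 * (v 1 * w 2 - v 2 * w 1) - u 1 * (v 0 * w 2 - v 2 * w 0) + u 2 * (v 0 * w 1 - v 1 * w 0)

/-- The bracket polynomial of six vectors of `ℝ³` that vanishes iff they are coconic. -/
def conicInv (v : Fin 6 → Fin 3 → ℝ) : ℝ :=
  bracket (v 0) (v 1) (v 2) * bracket (v 0) (v 3) (v 4) * bracket (v 1) (v 3) (v 5) *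
      bracket (v 2) (v 4) (v 5) -
    bracket (v 0) (v 1) (v 3) * bracket (v 0) (v 2) (v 4) * bracket (v 1) (v 2) (v 5) *
      bracket (v 3) (v 4) (v 5)

/-- All brackets with increasing indices are positive. -/
def BracketPos (v : Fin 6 → Fin 3 → ℝ) : Prop :=
  ∀ i j k, i < j → j < k → 0 < bracket (v i) (v j) (v k)

/-- `v` is a choice of representatives of the labeled configuration `f`. -/
def IsLift (f : Fin 6 → RP2) (v : Fin 6 → Fin 3 → ℝ) : Prop :=
  ∀ i, ∃ c : ℝ, c ≠ 0 ∧ v i = c • (f i).rep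

theorem bracket_ne_zero_iff {u v w : Fin 3 → ℝ} :
    bracket u v w ≠ 0 ↔ LinearIndependent ℝ ![u, v, w] := by
  have : bracket u v w = (Matrix.of ![u, v, w]).det := by
    simp [bracket, Matrix.det_fin_three]; ring
  rw [this, ← isUnit_iff_ne_zero, ← Matrix.isUnit_iff_isUnit_det,
    ← Matrix.linearIndependent_rows_iff_isUnit]
  rfl

theorem bracket_smul (a b c : ℝ) (u v w : Fin 3 → ℝ) :
    bracket (a • u) (b • v) (c • w) = a * b * c * bracket u v w := by
  simp only [bracket, Pi.smul_apply, smul_eq_mul]; ring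

theorem bracket_mulVec (M : Matrix (Fin 3) (Fin 3) ℝ) (u v w : Fin 3 → ℝ) :
    bracket (M.mulVec u) (M.mulVec v) (M.mulVec w) = M.det * bracket u v w := by
  simp only [bracket, Matrix.mulVec, dotProduct, Fin.sum_univ_three, Matrix.det_fin_three]; ring

theorem bracket_swap_left (u v w : Fin 3 → ℝ) : bracket v u w = -bracket u v w := by
  simp only [bracket]; ring

theorem bracket_swap_right (u v w : Fin 3 → ℝ) : bracket u w v = -bracket u v w := by
  simp only [bracket]; ring

theorem bracket_rotate (u v w : Fin 3 → ℝ) : bracket v w u = bracket u v w := by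
  simp only [bracket]; ring

theorem bracket_self_left (u v : Fin 3 → ℝ) : bracket u u v = 0 := by
  simp only [bracket]; ring

/-- The three-term Grassmann-Plücker relation. -/
theorem bracket_plucker (e a b c d : Fin 3 → ℝ) :
    bracket e a c * bracket e b d =
      bracket e a b * bracket e c d + bracket e a d * bracket e b c := by
  simp only [bracket]; ring

theorem conicInv_smul (c : Fin 6 → ℝ) (v : Fin 6 → Fin 3 → ℝ) :
    conicInv (fun i => c i • v i) = (∏ i, c i) ^ 2 * conicInv v := by
  simp only [conicInv, bracket_smul, Fin.prod_univ_six]; ring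

theorem conicInv_mulVec (M : Matrix (Fin 3) (Fin 3) ℝ) (v : Fin 6 → Fin 3 → ℝ) :
    conicInv (fun i => M.mulVec (v i)) = M.det ^ 4 * conicInv v := by
  simp only [conicInv, bracket_mulVec]; ring

/-- In the frame formed by three of the vectors, `conicInv` is a small determinant. -/
theorem conicInv_frame {v : Fin 6 → Fin 3 → ℝ} (h1 : v 1 = ![1, 0, 0]) (h3 : v 3 = ![0, 1, 0])
    (h5 : v 5 = ![0, 0, 1]) :
    conicInv v = (!![v 0 1 * v 0 2, v 0 0 * v 0 2, v 0 0 * v 0 1;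
      v 2 1 * v 2 2, v 2 0 * v 2 2, v 2 0 * v 2 1;
      v 4 1 * v 4 2, v 4 0 * v 4 2, v 4 0 * v 4 1]).det := by
  simp [Matrix.det_fin_three, conicInv, bracket, h1, h3, h5]; ring

theorem bracket_ne_zero_of_pos {v : Fin 6 → Fin 3 → ℝ} (hv : BracketPos v) {i j k : Fin 6}
    (hij : i ≠ j) (hik : i ≠ k) (hjk : j ≠ k) : bracket (v i) (v j) (v k) ≠ 0 := by
  intro h
  rcases hij.lt_or_gt with hij | hij <;> rcases hik.lt_or_gt with hik | hik <;>
    rcases hjk.lt_or_gt with hjk | hjk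
  · exact (hv _ _ _ hij hjk).ne' h
  · have := hv _ _ _ hik hjk
    simp only [bracket] at *; linarith
  · exact absurd (hij.trans hjk) hik.asymm
  · have := hv _ _ _ hik hij
    simp only [bracket] at *; linarith
  · have := hv _ _ _ hij hik
    simp only [bracket] at *; linarith
  · exact absurd (hik.trans hjk) hij.asymm
  · have := hv _ _ _ hjk hik
    simp only [bracket] at *; linarith
  · have := hv _ _ _ hjk hij
    simp only [bracket] at *; linarith

theorem bracketPos_add_one {v : Fin 6 → Fin 3 → ℝ} (hv : BracketPos v) :
    BracketPos fun i => v (i + 1) := by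
  intro i j k hij hjk
  rcases lt_or_ge k 5 with hk | hk
  · exact hv _ _ _ (by omega) (by omega)
  · obtain rfl : k = 5 := by omega
    change 0 < bracket (v (i + 1)) (v (j + 1)) (v 0)
    rw [bracket_rotate]
    exact hv _ _ _ (by omega) (by omega)

theorem bracketPos_neg {v : Fin 6 → Fin 3 → ℝ} (hv : BracketPos v) :
    BracketPos fun i => (-1 : ℝ) • v (-i) := by
  intro i j k hij hjk
  rw [bracket_smul]
  have key : ∀ i j : Fin 6, 0 < i → i < j → 0 < -j ∧ -j < -i := by decide
  rcases eq_or_ne i 0 with rfl | hi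
  · have := hv 0 (-k) (-j) (key j k hij hjk).1 (key j k hij hjk).2
    simp only [bracket, neg_zero] at *; linarith
  · have h0 := Fin.pos_iff_ne_zero.2 hi
    have := hv (-k) (-j) (-i) (key j k (h0.trans hij) hjk).2 (key i j h0 hij).2
    simp only [bracket] at *; linarith

theorem conicInv_add_one (v : Fin 6 → Fin 3 → ℝ) :
    conicInv (fun i => v (i + 1)) = -conicInv v := by
  simp only [conicInv, bracket]
  simp
  ring

theorem conicInv_neg (v : Fin 6 → Fin 3 → ℝ) :
    conicInv (fun i => v (-i)) = conicInv v := by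
  have h : conicInv (fun i => v (-i)) =
      bracket (v 0) (v 5) (v 4) * bracket (v 0) (v 3) (v 2) * bracket (v 5) (v 3) (v 1) *
        bracket (v 4) (v 2) (v 1) -
      bracket (v 0) (v 5) (v 3) * bracket (v 0) (v 4) (v 2) * bracket (v 5) (v 4) (v 1) *
        bracket (v 3) (v 2) (v 1) := rfl
  have h' : conicInv (fun i => v (i + 1)) =
      bracket (v 1) (v 2) (v 3) * bracket (v 1) (v 4) (v 5) * bracket (v 2) (v 4) (v 0) *
        bracket (v 3) (v 5) (v 0) -
      bracket (v 1) (v 2) (v 4) * bracket (v 1) (v 3) (v 5) * bracket (v 2) (v 3) (v 0) *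
        bracket (v 4) (v 5) (v 0) := rfl
  rw [← neg_inj, ← conicInv_add_one v, h, h']
  simp only [bracket]
  ring

theorem bracket_expand (a b x y : Fin 3 → ℝ) :
    bracket a b y • x = bracket x b y • a + bracket a x y • b + bracket a b x • y := by
  ext i
  fin_cases i <;> simp [bracket] <;> ring

theorem IsLift.ne_zero {f : Fin 6 → RP2} {v : Fin 6 → Fin 3 → ℝ} (h : IsLift f v) (i : Fin 6) :
    v i ≠ 0 := by
  obtain ⟨c, hc, e⟩ := h i
  rw [e]
  exact smul_ne_zero hc (f i).rep_nonzero

theorem IsLift.comp {f : Fin 6 → RP2} {v : Fin 6 → Fin 3 → ℝ} (h : IsLift f v)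
    (s : Fin 6 → Fin 6) : IsLift (fun i => f (s i)) fun i => v (s i) :=
  fun i => h (s i)

theorem IsLift.const_smul {f : Fin 6 → RP2} {v : Fin 6 → Fin 3 → ℝ} (h : IsLift f v) {a : ℝ}
    (ha : a ≠ 0) : IsLift f fun i => a • v i := fun i => by
  obtain ⟨c, hc, e⟩ := h i
  exact ⟨a * c, mul_ne_zero ha hc, by simp only [e, mul_smul]⟩

theorem IsLift.map_eq_zero {f : Fin 6 → RP2} {v : Fin 6 → Fin 3 → ℝ} (h : IsLift f v)
    (q : QuadraticForm ℝ (Fin 3 → ℝ)) (i : Fin 6) : q (v i) = 0 ↔ q (f i).rep = 0 := by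
  obtain ⟨c, hc, e⟩ := h i
  simp [e, QuadraticMap.map_smul, hc]

theorem isLift_rep (f : Fin 6 → RP2) : IsLift f fun i => (f i).rep :=
  fun i => ⟨1, one_ne_zero, by simp⟩

theorem isLift_mk {v : Fin 6 → Fin 3 → ℝ} (h : ∀ i, v i ≠ 0) :
    IsLift (fun i => Projectivization.mk ℝ (v i) (h i)) v := fun i => by
  obtain ⟨a, ha⟩ := Projectivization.exists_smul_eq_mk_rep ℝ (v i) (h i)
  exact ⟨(a⁻¹ : ℝˣ), a⁻¹.ne_zero, by rw [← ha, ← Units.smul_def, inv_smul_smul]⟩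

theorem IsLift.mk_eq {f : Fin 6 → RP2} {v : Fin 6 → Fin 3 → ℝ} (h : IsLift f v) (i : Fin 6) :
    Projectivization.mk ℝ (v i) (h.ne_zero i) = f i := by
  conv_rhs => rw [← (f i).mk_rep]
  rw [Projectivization.mk_eq_mk_iff']
  obtain ⟨c, hc, e⟩ := h i
  exact ⟨c, e.symm⟩

theorem IsLift.not_collin_iff {f : Fin 6 → RP2} {v : Fin 6 → Fin 3 → ℝ} (h : IsLift f v)
    (i j k : Fin 6) : ¬ Collin (f i) (f j) (f k) ↔ bracket (v i) (v j) (v k) ≠ 0 := by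
  obtain ⟨a, ha, ea⟩ := h i
  obtain ⟨b, hb, eb⟩ := h j
  obtain ⟨c, hc, ec⟩ := h k
  rw [Collin, not_not, ← bracket_ne_zero_iff, ea, eb, ec, bracket_smul]
  simp [ha, hb, hc]

/-- Three independent vectors of a configuration can be moved to the standard frame. -/
theorem exists_frame {v : Fin 6 → Fin 3 → ℝ} {a b c : Fin 6}
    (h : bracket (v a) (v b) (v c) ≠ 0) :
    ∃ (M : Matrix (Fin 3) (Fin 3) ℝ) (n : Fin 6 → Fin 3 → ℝ),
      M.det = bracket (v a) (v b) (v c) ∧ (∀ i, v i = M.mulVec (n i)) ∧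
        n a = ![1, 0, 0] ∧ n b = ![0, 1, 0] ∧ n c = ![0, 0, 1] := by
  set M : Matrix (Fin 3) (Fin 3) ℝ := (Matrix.of ![v a, v b, v c]).transpose with hM
  have hdet : M.det = bracket (v a) (v b) (v c) := by
    rw [hM, Matrix.det_transpose]; simp [bracket, Matrix.det_fin_three]; ring
  have hu : IsUnit M.det := by rw [hdet]; exact h.isUnit
  have key : ∀ (x y : Fin 3 → ℝ), x = M.mulVec y → M⁻¹.mulVec x = y := by
    rintro x y rfl
    rw [Matrix.mulVec_mulVec, Matrix.nonsing_inv_mul _ hu, Matrix.one_mulVec]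
  refine ⟨M, fun i => M⁻¹.mulVec (v i), hdet, fun i => ?_, key _ _ ?_, key _ _ ?_, key _ _ ?_⟩
  · rw [Matrix.mulVec_mulVec, Matrix.mul_nonsing_inv _ hu, Matrix.one_mulVec]
  all_goals ext i; fin_cases i <;> simp [hM, Matrix.mulVec, dotProduct, Fin.sum_univ_three]

/-- The quadratic form `A yz + B xz + C xy`. -/
def frameForm (A B C : ℝ) : QuadraticForm ℝ (Fin 3 → ℝ) :=
  A • QuadraticMap.linMulLin (LinearMap.proj 1) (LinearMap.proj 2) +
    B • QuadraticMap.linMulLin (LinearMap.proj 0) (LinearMap.proj 2) +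
      C • QuadraticMap.linMulLin (LinearMap.proj 0) (LinearMap.proj 1)

theorem frameForm_apply (A B C : ℝ) (p : Fin 3 → ℝ) :
    frameForm A B C p = A * (p 1 * p 2) + B * (p 0 * p 2) + C * (p 0 * p 1) := by
  simp [frameForm]

theorem exists_eq_frameForm {q : QuadraticForm ℝ (Fin 3 → ℝ)} (h0 : q ![1, 0, 0] = 0)
    (h1 : q ![0, 1, 0] = 0) (h2 : q ![0, 0, 1] = 0) : ∃ A B C, q = frameForm A B C := by
  refine ⟨QuadraticMap.polar q ![0, 1, 0] ![0, 0, 1], QuadraticMap.polar q ![1, 0, 0] ![0, 0, 1],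
    QuadraticMap.polar q ![1, 0, 0] ![0, 1, 0], ?_⟩
  ext p
  have e : p = p 0 • ![1, 0, 0] + p 1 • ![0, 1, 0] + p 2 • ![0, 0, 1] := by
    ext i; fin_cases i <;> simp
  rw [frameForm_apply]
  conv_lhs => rw [e]
  rw [QuadraticMap.map_add q, QuadraticMap.map_add q]
  simp only [QuadraticMap.map_smul, h0, h1, h2, QuadraticMap.polar_add_left,
    QuadraticMap.polar_smul_left, QuadraticMap.polar_smul_right, smul_eq_mul]
  ring

/-- A quadratic form vanishing on an independent triple, in the coordinates of that triple. -/
theorem exists_comp_eq_frameForm {q : QuadraticForm ℝ (Fin 3 → ℝ)}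
    {M : Matrix (Fin 3) (Fin 3) ℝ} (h0 : q (M.mulVec ![1, 0, 0]) = 0)
    (h1 : q (M.mulVec ![0, 1, 0]) = 0) (h2 : q (M.mulVec ![0, 0, 1]) = 0) :
    ∃ A B C, ∀ p, q (M.mulVec p) = frameForm A B C p := by
  obtain ⟨A, B, C, h⟩ := exists_eq_frameForm (q := q.comp M.mulVecLin) h0 h1 h2
  exact ⟨A, B, C, fun p => by rw [← h]; rfl⟩

theorem exists_conic_iff {v : Fin 6 → Fin 3 → ℝ} (h : bracket (v 1) (v 3) (v 5) ≠ 0) :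
    (∃ q : QuadraticForm ℝ (Fin 3 → ℝ), q ≠ 0 ∧ ∀ i, q (v i) = 0) ↔ conicInv v = 0 := by
  obtain ⟨M, n, hM, hv, h1, h3, h5⟩ := exists_frame h
  have hM0 : M.det ≠ 0 := by rwa [hM]
  have hinv : ∀ x, M.mulVec (M⁻¹.mulVec x) = x := fun x => by
    rw [Matrix.mulVec_mulVec, Matrix.mul_nonsing_inv _ hM0.isUnit, Matrix.one_mulVec]
  have hinv' : ∀ x, M⁻¹.mulVec (M.mulVec x) = x := fun x => by
    rw [Matrix.mulVec_mulVec, Matrix.nonsing_inv_mul _ hM0.isUnit, Matrix.one_mulVec]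
  have hD : conicInv v = M.det ^ 4 * conicInv n := by
    rw [← conicInv_mulVec, ← funext hv]
  rw [hD, conicInv_frame h1 h3 h5, mul_eq_zero, or_iff_right (pow_ne_zero 4 hM0),
    ← Matrix.exists_mulVec_eq_zero_iff]
  constructor
  · rintro ⟨q, hq, hqv⟩
    obtain ⟨A, B, C, hABC⟩ := exists_comp_eq_frameForm (q := q) (M := M)
      (by rw [← h1, ← hv, hqv]) (by rw [← h3, ← hv, hqv]) (by rw [← h5, ← hv, hqv])
    have hn : ∀ i, A * (n i 1 * n i 2) + B * (n i 0 * n i 2) + C * (n i 0 * n i 1) = 0 :=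
      fun i => by rw [← frameForm_apply, ← hABC, ← hv, hqv]
    refine ⟨![A, B, C], fun h0 => hq ?_, ?_⟩
    · have hA := congrFun h0 0
      have hB := congrFun h0 1
      have hC := congrFun h0 2
      simp only [Matrix.cons_val, Pi.zero_apply] at hA hB hC
      ext x
      rw [← hinv x, hABC, frameForm_apply, hA, hB, hC]
      simp
    · ext i
      fin_cases i <;> simp [Matrix.mulVec, dotProduct, Fin.sum_univ_three]
      · linarith [hn 0]
      · linarith [hn 2]
      · linarith [hn 4]
  · rintro ⟨a, ha, ha0⟩
    refine ⟨(frameForm (a 0) (a 1) (a 2)).comp M⁻¹.mulVecLin, fun hq => ha ?_, fun i => ?_⟩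
    · have key : ∀ p, frameForm (a 0) (a 1) (a 2) p = 0 := fun p => by
        have := congrArg (fun q : QuadraticForm ℝ (Fin 3 → ℝ) => q (M.mulVec p)) hq
        simpa [hinv'] using this
      have k0 := key ![0, 1, 1]
      have k1 := key ![1, 0, 1]
      have k2 := key ![1, 1, 0]
      rw [frameForm_apply] at k0 k1 k2
      simp at k0 k1 k2
      ext i
      fin_cases i <;> simp [k0, k1, k2]
    · rw [QuadraticMap.comp_apply, Matrix.mulVecLin_apply, hv i, hinv', frameForm_apply]
      have k0 := congrFun ha0 0
      have k1 := congrFun ha0 1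
      have k2 := congrFun ha0 2
      simp [Matrix.mulVec, dotProduct, Fin.sum_univ_three] at k0 k1 k2
      fin_cases i <;> simp [h1, h3, h5] <;> linarith

theorem IsLift.typicalCfg_iff {f : Fin 6 → RP2} {v : Fin 6 → Fin 3 → ℝ} (h : IsLift f v) :
    TypicalCfg f ↔ (∀ i j k, i ≠ j → i ≠ k → j ≠ k → bracket (v i) (v j) (v k) ≠ 0) ∧
      conicInv v ≠ 0 := by
  have coconic : ∀ g : Fin 6 → Fin 6, Function.Injective g →
      (Coconic (Set.range (f ∘ g)) ↔
        ∃ q : QuadraticForm ℝ (Fin 3 → ℝ), q ≠ 0 ∧ ∀ i, q (v i) = 0) := fun g hg => by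
    rw [(Finite.surjective_of_injective hg).range_comp, Coconic]
    simp [h.map_eq_zero]
  constructor
  · rintro ⟨⟨-, h1⟩, h2⟩
    have hb : ∀ i j k, i ≠ j → i ≠ k → j ≠ k → bracket (v i) (v j) (v k) ≠ 0 :=
      fun i j k hij hik hjk => (h.not_collin_iff i j k).1 (h1 i j k hij hik hjk)
    refine ⟨hb, fun hD => h2 id Function.injective_id ?_⟩
    rw [coconic _ Function.injective_id]
    exact (exists_conic_iff (hb 1 3 5 (by decide) (by decide) (by decide))).2 hD
  · rintro ⟨hb, hD⟩
    refine ⟨⟨fun i j hij => ?_, fun i j k hij hik hjk => ?_⟩, fun g hg hco => hD ?_⟩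
    · by_contra hne
      obtain ⟨k, hk1, hk2⟩ : ∃ k : Fin 6, i ≠ k ∧ j ≠ k := by
        have : ∀ i j : Fin 6, ∃ k, i ≠ k ∧ j ≠ k := by decide
        exact this i j
      refine (h.not_collin_iff i j k).2 (hb i j k hne hk1 hk2) ?_
      rw [Collin, hij, ← bracket_ne_zero_iff, bracket_self_left]
      simp
    · exact (h.not_collin_iff i j k).2 (hb i j k hij hik hjk)
    · exact (exists_conic_iff (hb 1 3 5 (by decide) (by decide) (by decide))).1
        ((coconic g hg).1 hco)

/-- A consecutive labeling in convex position has representatives with positive brackets. -/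
theorem ConsecConvexPos.exists_isLift {f : Fin 6 → RP2} (hf : TypicalCfg f)
    (hconv : ConsecConvexPos f) : ∃ v, IsLift f v ∧ BracketPos v := by
  obtain ⟨φ, ⟨-, hφ, -⟩, hψ⟩ := hconv
  set w : Fin 6 → Fin 3 → ℝ := fun i => chart φ (f i) with hw
  have hlift : IsLift f w := fun i => ⟨(φ (f i).rep)⁻¹, inv_ne_zero (hφ i), rfl⟩
  have hφw : ∀ i, φ (w i) = 1 := fun i => by simp [hw, chart, hφ i]
  have hb := (hlift.typicalCfg_iff.1 hf).1
  have hne : ∀ i : Fin 6, i ≠ i + 1 ∧ i ≠ i + 2 ∧ i + 1 ≠ i + 2 ∧ i + 3 ≠ i + 1 ∧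
    i + 3 ≠ i + 2 ∧ i + 1 ≠ i + 3 ∧ i + 2 ≠ i + 3 ∧ i + 2 ≠ i ∧ i + 1 + 1 = i + 2 := by decide
  have same : ∀ i j k, j ≠ i → j ≠ i + 1 → k ≠ i → k ≠ i + 1 →
      0 < bracket (w i) (w (i + 1)) (w j) * bracket (w i) (w (i + 1)) (w k) := by
    intro i j k hj hj' hk hk'
    obtain ⟨ψ, h1, h2⟩ := hψ i
    change ψ (w i) = ψ (w (i + 1)) at h1
    have hj2 : ψ (w j) < ψ (w i) := h2 j hj hj'
    have hk2 : ψ (w k) < ψ (w i) := h2 k hk hk'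
    have e := bracket_expand (w i) (w (i + 1)) (w j) (w k)
    have e1 := congrArg ψ e
    have e2 := congrArg φ e
    simp only [map_add, map_smul, smul_eq_mul, hφw, ← h1, mul_one] at e1 e2
    have bj := hb i (i + 1) j (hne i).1 hj.symm hj'.symm
    have bk := hb i (i + 1) k (hne i).1 hk.symm hk'.symm
    have e3 : bracket (w i) (w (i + 1)) (w j) * (ψ (w i) - ψ (w k)) =
      bracket (w i) (w (i + 1)) (w k) * (ψ (w i) - ψ (w j)) := by
      linear_combination e1 - ψ (w i) * e2
    have : 0 < (bracket (w i) (w (i + 1)) (w j) * bracket (w i) (w (i + 1)) (w k)) *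
        (ψ (w i) - ψ (w k)) := by
      have : bracket (w i) (w (i + 1)) (w j) * bracket (w i) (w (i + 1)) (w k) *
        (ψ (w i) - ψ (w k)) = bracket (w i) (w (i + 1)) (w k) ^ 2 * (ψ (w i) - ψ (w j)) := by
        linear_combination bracket (w i) (w (i + 1)) (w k) * e3
      rw [this]
      exact mul_pos (by positivity) (sub_pos.2 hj2)
    exact pos_of_mul_pos_left this (sub_pos.2 hk2).le
  have step : ∀ i, 0 < bracket (w i) (w (i + 1)) (w (i + 2)) *
      bracket (w (i + 1)) (w (i + 2)) (w (i + 3)) := fun i => by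
    have := same (i + 1) i (i + 3) (hne i).1 (by rw [(hne i).2.2.2.2.2.2.2.2]; exact (hne i).2.1)
      (hne i).2.2.2.1 (by rw [(hne i).2.2.2.2.2.2.2.2]; exact (hne i).2.2.2.2.1)
    rwa [(hne i).2.2.2.2.2.2.2.2, bracket_rotate] at this
  obtain ⟨ε, hε, hε0⟩ : ∃ ε : ℝ, ε ≠ 0 ∧ 0 < ε * ε * ε * bracket (w 0) (w 1) (w 2) := by
    rcases (hb 0 1 2 (by decide) (by decide) (by decide)).lt_or_gt with h | h
    · exact ⟨-1, by norm_num, by linarith⟩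
    · exact ⟨1, by norm_num, by linarith⟩
  have trans : ∀ x y : ℝ, 0 < x * y → 0 < ε * ε * ε * x → 0 < ε * ε * ε * y := fun x y h h' => by
    have h2 := mul_pos h h'
    have h3 : 0 < x ^ 2 := by
      have : x ≠ 0 := by rintro rfl; simp at h
      positivity
    refine pos_of_mul_pos_right (a := x ^ 2) ?_ h3.le
    linarith
  have base : ∀ i, 0 < ε * ε * ε * bracket (w i) (w (i + 1)) (w (i + 2)) := by
    have b1 := trans _ _ (step 0) hε0
    have b2 := trans _ _ (step 1) b1
    have b3 := trans _ _ (step 2) b2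
    have b4 := trans _ _ (step 3) b3
    have b5 := trans _ _ (step 4) b4
    intro i
    fin_cases i
    exacts [hε0, b1, b2, b3, b4, b5]
  have adj : ∀ i j, j ≠ i → j ≠ i + 1 → 0 < bracket (ε • w i) (ε • w (i + 1)) (ε • w j) :=
    fun i j h h' => by
      rw [bracket_smul]
      exact trans _ _ (same i (i + 2) j (hne i).2.2.2.2.2.2.2.1 (hne i).2.2.1.symm h h') (base i)
  refine ⟨fun i => ε • w i, hlift.const_smul hε, fun i j k hij hjk => ?_⟩
  have plucker : ∀ e a b c d : Fin 6,
      0 < bracket (ε • w e) (ε • w a) (ε • w b) → 0 < bracket (ε • w e) (ε • w c) (ε • w d) →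
      0 < bracket (ε • w e) (ε • w a) (ε • w d) → 0 < bracket (ε • w e) (ε • w b) (ε • w c) →
      0 < bracket (ε • w e) (ε • w a) (ε • w c) →
      0 < bracket (ε • w e) (ε • w b) (ε • w d) := fun e a b c d h1 h2 h3 h4 h5 => by
    refine pos_of_mul_pos_right ?_ h5.le
    rw [bracket_plucker]
    exact add_pos (mul_pos h1 h2) (mul_pos h3 h4)
  have hcases : ∀ i j k : Fin 6, i < j → j < k → (j = i + 1 ∧ k ≠ i ∧ k ≠ i + 1) ∨
      (k = j + 1 ∧ i ≠ j ∧ i ≠ j + 1) ∨ (i = 0 ∧ k = 5 ∧ j ≠ 5 ∧ j ≠ 5 + 1) ∨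
      (i = 0 ∧ j = 2 ∧ k = 4) ∨ (i = 1 ∧ j = 3 ∧ k = 5) := by decide
  rcases hcases i j k hij hjk with ⟨rfl, h1, h2⟩ | ⟨rfl, h1, h2⟩ | ⟨rfl, rfl, h1, h2⟩ |
    ⟨rfl, rfl, rfl⟩ | ⟨rfl, rfl, rfl⟩
  · exact adj i k h1 h2
  · rw [← bracket_rotate]; exact adj j i h1 h2
  · rw [← bracket_rotate, ← bracket_rotate]; exact adj 5 j h1 h2
  · refine plucker 0 1 2 3 4 (adj 0 2 (by decide) (by decide)) ?_ (adj 0 4 (by decide) (by decide))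
      ?_ (adj 0 3 (by decide) (by decide))
    · rw [← bracket_rotate]; exact adj 3 0 (by decide) (by decide)
    · rw [← bracket_rotate]; exact adj 2 0 (by decide) (by decide)
  · refine plucker 1 2 3 4 5 (adj 1 3 (by decide) (by decide)) ?_ (adj 1 5 (by decide) (by decide))
      ?_ (adj 1 4 (by decide) (by decide))
    · rw [← bracket_rotate]; exact adj 4 1 (by decide) (by decide)
    · rw [← bracket_rotate]; exact adj 3 1 (by decide) (by decide)

theorem exists_mem_ker_mul_nonpos {A B C s l m n : ℝ} (hs : 0 < s * (A * B * C)) :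
    ∃ p : Fin 3 → ℝ, p ≠ 0 ∧ l * p 0 + m * p 1 + n * p 2 = 0 ∧ s * frameForm A B C p ≤ 0 := by
  by_cases hl : l = 0
  · exact ⟨![1, 0, 0], fun h => by simpa using congrFun h 0, by simp [hl],
      by simp [frameForm_apply]⟩
  by_cases hm : m = 0
  · exact ⟨![0, 1, 0], fun h => by simpa using congrFun h 1, by simp [hm],
      by simp [frameForm_apply]⟩
  by_cases hn : n = 0
  · exact ⟨![0, 0, 1], fun h => by simpa using congrFun h 2, by simp [hn],
      by simp [frameForm_apply]⟩
  by_contra! h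
  have h0 := h ![0, n, -m] (fun h => hn (by simpa using congrFun h 1)) (by simp; ring)
  have h1 := h ![n, 0, -l] (fun h => hn (by simpa using congrFun h 0)) (by simp; ring)
  have h2 := h ![m, -l, 0] (fun h => hm (by simpa using congrFun h 0)) (by simp; ring)
  simp only [frameForm_apply, Matrix.cons_val] at h0 h1 h2
  have key := mul_pos (mul_pos h0 h1) h2
  have : 0 ≤ s * (A * B * C) * (s * l * m * n) ^ 2 := mul_nonneg hs.le (sq_nonneg _)
  linarith

theorem exists_eq_ker_of_finrank {W : Submodule ℝ (Fin 3 → ℝ)} (hW : Module.finrank ℝ W = 2) :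
    ∃ φ : (Fin 3 → ℝ) →ₗ[ℝ] ℝ, W = LinearMap.ker φ := by
  have hlt : W < ⊤ := by
    refine lt_top_iff_ne_top.2 ?_
    rintro rfl
    simp at hW
  obtain ⟨φ, hφ, hle⟩ := W.exists_le_ker_of_lt_top hlt
  refine ⟨φ, Submodule.eq_of_le_of_finrank_le hle ?_⟩
  have h1 := φ.finrank_range_add_finrank_ker
  have h2 : LinearMap.range φ = ⊤ := LinearMap.range_eq_top.2 (LinearMap.surjective hφ)
  rw [h2] at h1
  simp at h1
  omega

theorem finrank_ker_eq_two {φ : (Fin 3 → ℝ) →ₗ[ℝ] ℝ} (hφ : φ ≠ 0) :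
    Module.finrank ℝ (LinearMap.ker φ) = 2 := by
  have h1 := φ.finrank_range_add_finrank_ker
  have h2 : LinearMap.range φ = ⊤ := LinearMap.range_eq_top.2 (LinearMap.surjective hφ)
  rw [h2] at h1
  simp at h1
  omega

/-- A plane on which a quadratic form changes sign contains an isotropic vector. -/
theorem exists_isotropic {q : QuadraticForm ℝ (Fin 3 → ℝ)} {W : Submodule ℝ (Fin 3 → ℝ)}
    {r w : Fin 3 → ℝ} (hr : r ∈ W) (hw : w ∈ W) (hw0 : w ≠ 0) (h : q r * q w ≤ 0)
    (hqr : q r ≠ 0) : ∃ u ∈ W, u ≠ 0 ∧ q u = 0 := by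
  by_cases hqw : q w = 0
  · exact ⟨w, hw, hw0, hqw⟩
  have hneg : q r * q w < 0 := h.lt_of_ne (mul_ne_zero hqr hqw)
  obtain ⟨s, hs⟩ := exists_quadratic_eq_zero (a := q r) (b := QuadraticMap.polar q r w)
    (c := q w) hqr ⟨√(discrim (q r) (QuadraticMap.polar q r w) (q w)),
      (Real.mul_self_sqrt (by unfold discrim; nlinarith [sq_nonneg (QuadraticMap.polar q r w)])).symm⟩
  refine ⟨s • r + w, W.add_mem (W.smul_mem s hr) hw, fun h0 => ?_, ?_⟩
  · have : w = (-s) • r := by rw [neg_smul]; exact (eq_neg_of_add_eq_zero_right h0)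
    rw [this, QuadraticMap.map_smul, smul_eq_mul] at hneg
    nlinarith [mul_self_nonneg (s * q r)]
  · rw [QuadraticMap.map_add q, QuadraticMap.map_smul, QuadraticMap.polar_smul_left]
    simp only [smul_eq_mul]
    linarith

theorem insideConic_of_pos {q : QuadraticForm ℝ (Fin 3 → ℝ)} {M : Matrix (Fin 3) (Fin 3) ℝ}
    (hM : M.det ≠ 0) {A B C : ℝ} (hq : ∀ p, q (M.mulVec p) = frameForm A B C p) {x : RP2}
    (h : 0 < q x.rep * (A * B * C)) : InsideConic q x := by
  rintro _ ⟨W, hW, rfl⟩ hx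
  obtain ⟨φ, rfl⟩ := exists_eq_ker_of_finrank hW
  obtain ⟨p, hp, hp0, hqp⟩ := exists_mem_ker_mul_nonpos (l := φ (M.mulVec ![1, 0, 0]))
    (m := φ (M.mulVec ![0, 1, 0])) (n := φ (M.mulVec ![0, 0, 1])) h
  have hker : M.mulVec p ∈ LinearMap.ker φ := by
    have e : p = p 0 • ![1, 0, 0] + p 1 • ![0, 1, 0] + p 2 • ![0, 0, 1] := by
      ext i; fin_cases i <;> simp
    rw [LinearMap.mem_ker, e]
    simp only [Matrix.mulVec_add, Matrix.mulVec_smul, map_add, map_smul, smul_eq_mul]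
    linarith
  have hp' : M.mulVec p ≠ 0 := fun h0 => hp (Matrix.eq_zero_of_mulVec_eq_zero hM h0)
  rw [← hq] at hqp
  obtain ⟨u, hu, hu0, hqu⟩ := exists_isotropic hx hker hp' hqp (left_ne_zero_of_mul h.ne')
  obtain ⟨a, ha⟩ := Projectivization.exists_smul_eq_mk_rep ℝ u hu0
  refine ⟨Projectivization.mk ℝ u hu0, ?_, ?_⟩
  · change (Projectivization.mk ℝ u hu0).rep ∈ LinearMap.ker φ
    rw [← ha]
    exact Submodule.smul_mem _ _ hu
  · change q (Projectivization.mk ℝ u hu0).rep = 0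
    rw [← ha, Units.smul_def, QuadraticMap.map_smul, hqu, smul_zero]

/-- A definiteness criterion for the conic `yz + xz + xy = 0` on a line. -/
theorem eq_zero_of_dual_pos {P Q R L M N : ℝ} (hline : L * P + M * Q + N * R = 0)
    (hconic : Q * R + P * R + P * Q = 0)
    (hpos : 0 < 2 * (L * M + L * N + M * N) - L ^ 2 - M ^ 2 - N ^ 2) :
    P = 0 ∧ Q = 0 ∧ R = 0 := by
  have hN : N ≠ 0 := by rintro rfl; nlinarith [sq_nonneg (L - M)]
  have hL : L ≠ 0 := by rintro rfl; nlinarith [sq_nonneg (M - N)]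
  have e : L * P ^ 2 + (L + M - N) * (P * Q) + M * Q ^ 2 = 0 := by
    linear_combination (P + Q) * hline - N * hconic
  have e' : (2 * L * P + (L + M - N) * Q) ^ 2 +
      (2 * (L * M + L * N + M * N) - L ^ 2 - M ^ 2 - N ^ 2) * Q ^ 2 = 0 := by
    linear_combination 4 * L * e
  have hQ : Q = 0 := by
    by_contra hQ
    have : 0 < Q ^ 2 := by positivity
    nlinarith [mul_pos hpos this, sq_nonneg (2 * L * P + (L + M - N) * Q)]
  subst hQ
  have hP : P = 0 := by simpa [hL] using e'
  subst hP
  simpa [hN] using hline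

theorem outsideConic_of_neg {q : QuadraticForm ℝ (Fin 3 → ℝ)} {M : Matrix (Fin 3) (Fin 3) ℝ}
    (hM : M.det ≠ 0) {A B C : ℝ} (hq : ∀ p, q (M.mulVec p) = frameForm A B C p) {x : RP2}
    (h : q x.rep * (A * B * C) < 0) : OutsideConic q x := by
  have hinv : ∀ x, M.mulVec (M⁻¹.mulVec x) = x := fun x => by
    rw [Matrix.mulVec_mulVec, Matrix.mul_nonsing_inv _ hM.isUnit, Matrix.one_mulVec]
  have hABC := right_ne_zero_of_mul h.ne
  have hA : A ≠ 0 := left_ne_zero_of_mul (left_ne_zero_of_mul hABC)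
  have hB : B ≠ 0 := right_ne_zero_of_mul (left_ne_zero_of_mul hABC)
  have hC : C ≠ 0 := right_ne_zero_of_mul hABC
  have form : ∀ y : Fin 3 → ℝ, q (M.mulVec y) = (A * B * C) *
      (y 1 / B * (y 2 / C) + y 0 / A * (y 2 / C) + y 0 / A * (y 1 / B)) := fun y => by
    rw [hq, frameForm_apply]; field_simp
  set z := M⁻¹.mulVec x.rep with hz
  set X := z 0 / A with hX
  set Y := z 1 / B with hY
  set Z := z 2 / C with hZ
  set σ := Y * Z + X * Z + X * Y with hσ
  have hσneg : σ < 0 := by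
    have h1 := form z
    rw [hz, hinv, ← hz] at h1
    rw [h1] at h
    have h2 : 0 < (A * B * C) ^ 2 := by positivity
    have h3 : (A * B * C) ^ 2 * σ < 0 := by rw [hσ]; linarith
    exact neg_of_mul_neg_right h3 h2.le
  set L := σ - (X + Y + Z) * (Y + Z) / 2 with hL
  set K := σ - (X + Y + Z) * (X + Z) / 2 with hK
  set N := σ - (X + Y + Z) * (X + Y) / 2 with hN
  have hdual : 0 < 2 * (L * K + L * N + K * N) - L ^ 2 - K ^ 2 - N ^ 2 := by
    have : 2 * (L * K + L * N + K * N) - L ^ 2 - K ^ 2 - N ^ 2 =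
        3 * σ ^ 2 - σ * (X + Y + Z) ^ 2 := by
      rw [hL, hK, hN, hσ]; ring
    rw [this]
    have h1 : 0 < σ ^ 2 := sq_pos_of_neg hσneg
    have h2 : 0 ≤ (-σ) * (X + Y + Z) ^ 2 := mul_nonneg (by linarith) (sq_nonneg _)
    linarith
  let φ : (Fin 3 → ℝ) →ₗ[ℝ] ℝ := ((L / A) • LinearMap.proj 0 + (K / B) • LinearMap.proj 1 +
    (N / C) • LinearMap.proj 2) ∘ₗ M⁻¹.mulVecLin
  have hφ : ∀ u, φ u = L * (M⁻¹.mulVec u 0 / A) + K * (M⁻¹.mulVec u 1 / B) +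
      N * (M⁻¹.mulVec u 2 / C) := fun u => by
    simp [φ]; ring
  have hker : ∀ u : Fin 3 → ℝ, φ u = 0 → q u = 0 → u = 0 := fun u h1 h2 => by
    rw [hφ] at h1
    rw [← hinv u, form] at h2
    obtain ⟨h3, h4, h5⟩ := eq_zero_of_dual_pos h1 ((mul_eq_zero.1 h2).resolve_left hABC) hdual
    rw [← hinv u]
    have : M⁻¹.mulVec u = 0 := by
      ext i; fin_cases i
      · simpa [hA] using h3
      · simpa [hB] using h4
      · simpa [hC] using h5
    rw [this, Matrix.mulVec_zero]
  have hφ0 : φ ≠ 0 := by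
    intro h0
    have h1 := hker (M.mulVec ![1, 0, 0]) (by rw [h0]; rfl) (by simp [hq, frameForm_apply])
    have h2 := Matrix.eq_zero_of_mulVec_eq_zero hM h1
    simpa using congrFun h2 0
  refine ⟨{p | p.rep ∈ LinearMap.ker φ}, ⟨_, finrank_ker_eq_two hφ0, rfl⟩, ?_, ?_⟩
  · change φ x.rep = 0
    rw [hφ, ← hz, ← hX, ← hY, ← hZ, hL, hK, hN, hσ]
    ring
  · rw [Set.eq_empty_iff_forall_notMem]
    rintro p ⟨h1, h2⟩
    exact p.rep_nonzero (hker _ h1 h2)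

/-- The first point of a consecutively labeled configuration is dominant iff `conicInv` is
negative. -/
theorem dominant_zero_iff {f : Fin 6 → RP2} {v : Fin 6 → Fin 3 → ℝ} (hf : IsLift f v)
    (hv : BracketPos v) (hD : conicInv v ≠ 0) : Dominant f 0 ↔ conicInv v < 0 := by
  have hδ : 0 < bracket (v 1) (v 3) (v 5) := hv 1 3 5 (by decide) (by decide)
  obtain ⟨M, n, hM, hvn, h1, h3, h5⟩ := exists_frame hδ.ne'
  rw [← hM] at hδ
  have hn : BracketPos n := fun i j k hij hjk => by
    have := hv i j k hij hjk
    rw [hvn, hvn, hvn, bracket_mulVec] at this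
    exact pos_of_mul_pos_right this hδ.le
  have hDn : conicInv v = M.det ^ 4 * conicInv n := by
    rw [← conicInv_mulVec, ← funext hvn]
  have hcn := conicInv_frame h1 h3 h5
  rw [Matrix.det_fin_three] at hcn
  simp at hcn
  have x0 := hn 0 3 5 (by decide) (by decide)
  have y0 := hn 0 1 5 (by decide) (by decide)
  have z0 := hn 0 1 3 (by decide) (by decide)
  have x2 := hn 2 3 5 (by decide) (by decide)
  have y2 := hn 1 2 5 (by decide) (by decide)
  have z2 := hn 1 2 3 (by decide) (by decide)
  have x4 := hn 3 4 5 (by decide) (by decide)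
  have y4 := hn 1 4 5 (by decide) (by decide)
  have z4 := hn 1 3 4 (by decide) (by decide)
  have m := hn 2 3 4 (by decide) (by decide)
  simp [bracket, h1, h3, h5] at x0 y0 z0 x2 y2 z2 x4 y4 z4 m
  set A := n 2 0 * n 2 2 * (n 4 0 * n 4 1) - n 2 0 * n 2 1 * (n 4 0 * n 4 2) with hA
  set B := n 2 0 * n 2 1 * (n 4 1 * n 4 2) - n 2 1 * n 2 2 * (n 4 0 * n 4 1) with hB
  set C := n 2 1 * n 2 2 * (n 4 0 * n 4 2) - n 2 0 * n 2 2 * (n 4 1 * n 4 2) with hC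
  have hApos : 0 < A := by
    rw [hA]
    have h := mul_pos (mul_pos x2 (neg_pos.2 x4))
      (add_pos (mul_pos (neg_pos.2 z2) y4) (mul_pos y2 z4))
    linarith
  have hBpos : 0 < B := by
    rw [hB]
    have h := mul_pos (mul_pos y2 y4) (sub_pos.2 m)
    linarith
  have hCpos : 0 < C := by
    rw [hC]
    have h := mul_pos (mul_pos (neg_pos.2 z2) z4)
      (add_pos (mul_pos y2 (neg_pos.2 x4)) (mul_pos x2 y4))
    linarith
  have hcn' : conicInv n = frameForm A B C (n 0) := by
    rw [frameForm_apply, hcn, hA, hB, hC]; ring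
  obtain ⟨c, hc, e⟩ := hf 0
  have hsign : ∀ (q : QuadraticForm ℝ (Fin 3 → ℝ)) (k : ℝ),
      (∀ p, q (M.mulVec p) = k * frameForm A B C p) →
      q (f 0).rep * ((k * A) * (k * B) * (k * C)) * (c ^ 2 * M.det ^ 4) =
        k ^ 4 * (A * B * C) * conicInv v := by
    intro q k hk
    have h6 : c * c * q (f 0).rep = k * frameForm A B C (n 0) := by
      rw [← hk, ← hvn, e, QuadraticMap.map_smul, smul_eq_mul]
    rw [hDn, hcn']
    linear_combination (k ^ 3 * (A * B * C) * M.det ^ 4) * h6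
  have hscale : ∀ k p, k * frameForm A B C p = frameForm (k * A) (k * B) (k * C) p := by
    intro k p; simp only [frameForm_apply]; ring
  have hcM : 0 < c ^ 2 * M.det ^ 4 := by positivity
  have hABC : 0 < A * B * C := by positivity
  constructor
  · intro hdom
    by_contra hneg
    have hDpos : 0 < conicInv v := lt_of_le_of_ne (not_lt.1 hneg) hD.symm
    set q : QuadraticForm ℝ (Fin 3 → ℝ) := (frameForm A B C).comp M⁻¹.mulVecLin with hq
    have hqM : ∀ p, q (M.mulVec p) = frameForm A B C p := fun p => by
      rw [hq, QuadraticMap.comp_apply, Matrix.mulVecLin_apply, Matrix.mulVec_mulVec,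
        Matrix.nonsing_inv_mul _ hδ.ne'.isUnit, Matrix.one_mulVec]
    have hq0 : q ≠ 0 := by
      intro h0
      have h2 := hqM ![0, 1, 1]
      rw [h0, frameForm_apply] at h2
      simp at h2
      exact hApos.ne h2
    have hvan : ∀ j, j ≠ 0 → q (f j).rep = 0 := by
      intro j hj
      rw [← hf.map_eq_zero, hvn, hqM, frameForm_apply]
      fin_cases j
      · exact absurd rfl hj
      · simp [h1]
      · simp [hA, hB, hC]; ring
      · simp [h3]
      · simp [hA, hB, hC]; ring
      · simp [h5]
    obtain ⟨L, hL, h0, hemp⟩ := hdom q hq0 hvan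
    have hs := hsign q 1 fun p => by rw [hqM, one_mul]
    simp only [one_mul, one_pow] at hs
    have hin := insideConic_of_pos hδ.ne' hqM (x := f 0)
      (pos_of_mul_pos_left (by rw [hs]; positivity) hcM.le)
    exact (hin L hL h0).ne_empty hemp
  · intro hneg q hq hvan
    replace hvan : ∀ j, j ≠ 0 → q (M.mulVec (n j)) = 0 := fun j hj => by
      rw [← hvn, hf.map_eq_zero, hvan j hj]
    obtain ⟨A', B', C', hq'⟩ := exists_comp_eq_frameForm (q := q) (M := M)
      (by rw [← h1, hvan 1 (by decide)]) (by rw [← h3, hvan 3 (by decide)])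
      (by rw [← h5, hvan 5 (by decide)])
    have e2 := hvan 2 (by decide)
    have e4 := hvan 4 (by decide)
    rw [hq', frameForm_apply] at e2 e4
    have hAB : B' * A = A' * B := by
      rw [hA, hB]
      linear_combination (n 4 0 * n 4 1) * e2 - (n 2 0 * n 2 1) * e4
    have hAC : C' * A = A' * C := by
      rw [hA, hC]
      linear_combination (n 2 0 * n 2 2) * e4 - (n 4 0 * n 4 2) * e2
    have hk : ∀ p, q (M.mulVec p) = A' / A * frameForm A B C p := fun p => by
      rw [hq', frameForm_apply, frameForm_apply]
      field_simp
      linear_combination (p 0 * p 2) * hAB + (p 0 * p 1) * hAC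
    have hA' : A' / A ≠ 0 := by
      intro h0
      refine hq (QuadraticMap.ext fun x => ?_)
      have : x = M.mulVec (M⁻¹.mulVec x) := by
        rw [Matrix.mulVec_mulVec, Matrix.mul_nonsing_inv _ hδ.ne'.isUnit, Matrix.one_mulVec]
      rw [this, hk, h0]
      simp
    refine outsideConic_of_neg hδ.ne' (fun p => (hk p).trans (hscale _ p)) ?_
    refine neg_of_mul_neg_left ?_ hcM.le
    rw [hsign q _ hk]
    have : 0 < (A' / A) ^ 4 := by positivity
    exact mul_neg_of_pos_of_neg (mul_pos this hABC) hneg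

theorem conicInv_add (v : Fin 6 → Fin 3 → ℝ) (k : Fin 6) :
    conicInv (fun i => v (i + k)) = (-1) ^ (k : ℕ) * conicInv v := by
  obtain ⟨k, hk⟩ := k
  induction k with
  | zero => simp
  | succ k ih =>
    have h := conicInv_add_one fun i => v (i + ⟨k, by omega⟩)
    rw [ih] at h
    have e : (⟨k + 1, hk⟩ : Fin 6) = 1 + ⟨k, by omega⟩ := by
      ext; simp [Fin.val_add]; omega
    simp only [e, ← add_assoc, h]
    simp [pow_succ]

theorem bracketPos_add {v : Fin 6 → Fin 3 → ℝ} (hv : BracketPos v) (k : Fin 6) :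
    BracketPos fun i => v (i + k) := by
  obtain ⟨k, hk⟩ := k
  induction k with
  | zero => simpa using hv
  | succ k ih =>
    have h := bracketPos_add_one (ih (by omega))
    have e : (⟨k + 1, hk⟩ : Fin 6) = 1 + ⟨k, by omega⟩ := by
      ext; simp [Fin.val_add]; omega
    simpa only [e, ← add_assoc] using h

theorem dominant_iff {f : Fin 6 → RP2} {v : Fin 6 → Fin 3 → ℝ} (hf : IsLift f v)
    (hv : BracketPos v) (hD : conicInv v ≠ 0) (i : Fin 6) :
    Dominant f i ↔ (-1) ^ (i : ℕ) * conicInv v < 0 := by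
  rw [← conicInv_add, ← dominant_zero_iff (hf.comp _) (bracketPos_add hv i)
    (by rw [conicInv_add]; exact mul_ne_zero (pow_ne_zero _ (by norm_num)) hD)]
  simp only [Dominant, zero_add]
  refine forall_congr' fun q => imp_congr_right fun _ => imp_congr_left ?_
  constructor
  · intro h j hj
    exact h (j + i) fun h0 => hj (by simpa using h0)
  · intro h j hj
    simpa using h (j - i) (sub_ne_zero.2 hj)

/-- The quotient map from nonzero vectors to the projective plane is an open quotient map. -/
theorem isOpenMap_mk :
    IsOpenMap fun u : {u : Fin 3 → ℝ // u ≠ 0} => Projectivization.mk ℝ (u : Fin 3 → ℝ) u.2 := by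
  intro s hs
  refine isOpen_coinduced.2 ?_
  have e : (Quotient.mk'' : {u : Fin 3 → ℝ // u ≠ 0} → RP2) ⁻¹'
      ((fun u : {u : Fin 3 → ℝ // u ≠ 0} => Projectivization.mk ℝ (u : Fin 3 → ℝ) u.2) '' s) =
      ⋃ a : ℝˣ, (fun u : {u : Fin 3 → ℝ // u ≠ 0} =>
        (⟨a • (u : Fin 3 → ℝ), (smul_ne_zero_iff_ne a).2 u.2⟩ : {u : Fin 3 → ℝ // u ≠ 0})) ⁻¹' s := by
    ext u
    simp only [Set.mem_preimage, Set.mem_iUnion]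
    constructor
    · rintro ⟨x, hx, h⟩
      obtain ⟨a, ha⟩ := (Projectivization.mk_eq_mk_iff ℝ _ _ x.2 u.2).1 h
      exact ⟨a, by convert hx⟩
    · rintro ⟨a, ha⟩
      exact ⟨_, ha, (Projectivization.mk_eq_mk_iff ℝ _ _ _ u.2).2 ⟨a, rfl⟩⟩
  exact e ▸ isOpen_iUnion fun a => hs.preimage
    ((continuous_subtype_val.const_smul (a : ℝ)).subtype_mk _)

theorem continuous_mk {X : Type*} [TopologicalSpace X] {g : X → Fin 3 → ℝ} (hg : Continuous g)
    (h0 : ∀ x, g x ≠ 0) : Continuous fun x => (Projectivization.mk ℝ (g x) (h0 x) : RP2) := by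
  have h : Continuous (Quotient.mk'' : {u : Fin 3 → ℝ // u ≠ 0} → RP2) := continuous_quot_mk
  exact h.comp (hg.subtype_mk h0)

theorem isOpen_setOf_isLift_pos {F : (Fin 6 → Fin 3 → ℝ) → ℝ} (hF : Continuous F) :
    IsOpen {p : Fin 6 → RP2 | ∃ v, IsLift p v ∧ 0 < F v} := by
  have hopen := IsOpenMap.piMap (fun _ : Fin 6 => isOpenMap_mk)
    (Filter.Eventually.of_forall fun _ p => ⟨⟨p.rep, p.rep_nonzero⟩, p.mk_rep⟩)
  have hU : IsOpen {u : Fin 6 → {u : Fin 3 → ℝ // u ≠ 0} | 0 < F fun i => u i} :=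
    isOpen_lt continuous_const (hF.comp (continuous_pi fun i =>
      continuous_subtype_val.comp (continuous_apply i)))
  convert hopen _ hU using 1
  ext p
  constructor
  · rintro ⟨v, hv, h⟩
    exact ⟨fun i => ⟨v i, hv.ne_zero i⟩, h, funext hv.mk_eq⟩
  · rintro ⟨u, h, rfl⟩
    exact ⟨_, isLift_mk fun i => (u i).2, h⟩

/-- The sign of a function of six vectors that is invariant under rescaling and does not vanish
on typical configurations is constant along Q-deformations. -/
theorem QDeformFam.pos_of_pos {γ : Fin 6 → unitInterval → RP2} (hγ : QDeformFam 6 γ)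
    {F : (Fin 6 → Fin 3 → ℝ) → ℝ} (hF : Continuous F)
    (hscale : ∀ c : Fin 6 → ℝ, (∀ i, c i ≠ 0) → ∀ v, 0 < F v → 0 < F fun i => c i • v i)
    (hne : ∀ p v, IsLift p v → TypicalCfg p → F v ≠ 0)
    {s t : unitInterval} {v w : Fin 6 → Fin 3 → ℝ} (hv : IsLift (fun i => γ i s) v)
    (hw : IsLift (fun i => γ i t) w) (h : 0 < F v) : 0 < F w := by
  have same : ∀ p v w, IsLift p v → IsLift p w → 0 < F v → 0 < F w := by
    intro p v w hv hw h
    choose a ha ea using hv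
    choose b hb eb using hw
    have := hscale (fun i => b i / a i) (fun i => div_ne_zero (hb i) (ha i)) v h
    convert this using 2
    ext1 i
    rw [ea, eb, smul_smul, div_mul_cancel₀ _ (ha i)]
  have hcont : Continuous fun t => fun i => γ i t := continuous_pi hγ.1
  set S : Set unitInterval := (fun t i => γ i t) ⁻¹' {p | ∃ v, IsLift p v ∧ 0 < F v} with hS
  have hopen : IsOpen S := (isOpen_setOf_isLift_pos hF).preimage hcont
  have hcompl : Sᶜ = (fun t i => γ i t) ⁻¹' {p | ∃ v, IsLift p v ∧ 0 < -F v} := by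
    ext r
    constructor
    · intro hr
      have hl := isLift_rep fun i => γ i r
      refine ⟨_, hl, ?_⟩
      have h1 := hne _ _ hl (hγ.2 r)
      have h2 : ¬ 0 < F _ := fun h => hr ⟨_, hl, h⟩
      exact neg_pos.2 (lt_of_le_of_ne (not_lt.1 h2) h1)
    · rintro ⟨v, hv, h⟩ ⟨w, hw, h'⟩
      have := same _ _ _ hw hv h'
      linarith
  have hclopen : IsClopen S := ⟨isOpen_compl_iff.1
    (hcompl ▸ (isOpen_setOf_isLift_pos hF.neg).preimage hcont), hopen⟩
  have hs : s ∈ S := ⟨v, hv, h⟩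
  have ht : t ∈ S := hclopen.eq_univ ⟨s, hs⟩ ▸ Set.mem_univ t
  obtain ⟨u, hu, h'⟩ := ht
  exact same _ _ _ hu hw h'

theorem continuous_bracket (i j k : Fin 6) :
    Continuous fun v : Fin 6 → Fin 3 → ℝ => bracket (v i) (v j) (v k) := by
  unfold bracket; fun_prop

theorem continuous_conicInv : Continuous conicInv := by
  unfold conicInv bracket; fun_prop

theorem RealizedPerm.conicInv_pos {f : Fin 6 → RP2} {σ : Equiv.Perm (Fin 6)}
    (h : RealizedPerm f σ) {v : Fin 6 → Fin 3 → ℝ} (hv : IsLift f v) :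
    0 < conicInv v * conicInv fun i => v (σ i) := by
  obtain ⟨γ, hγ, h0, h1⟩ := h
  have hv0 : IsLift (fun i => γ i 0) v := by simpa only [h0] using hv
  have hv1 : IsLift (fun i => γ i 1) fun i => v (σ i) := by simpa only [h1] using hv.comp σ
  have hsq : ∀ c : Fin 6 → ℝ, (∀ i, c i ≠ 0) → 0 < (∏ i, c i) ^ 2 := fun c hc =>
    sq_pos_of_ne_zero (Finset.prod_ne_zero_iff.2 fun i _ => hc i)
  rcases ((hv0.typicalCfg_iff.1 (hγ.2 0)).2).lt_or_gt with h | h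
  · have := hγ.pos_of_pos (F := fun v => -conicInv v) continuous_conicInv.neg
      (fun c hc v h => by rw [conicInv_smul]; have := mul_pos (hsq c hc) h; linarith)
      (fun p v hv hp => neg_ne_zero.2 (hv.typicalCfg_iff.1 hp).2) hv0 hv1 (neg_pos.2 h)
    exact mul_pos_of_neg_of_neg h (neg_pos.1 this)
  · exact mul_pos h <| hγ.pos_of_pos continuous_conicInv
      (fun c hc v h => by rw [conicInv_smul]; exact mul_pos (hsq c hc) h)
      (fun p v hv hp => (hv.typicalCfg_iff.1 hp).2) hv0 hv1 h

/-- The sign of the bracket of three points of a consecutively labeled convex hexagon. -/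
def chirotope (i j k : Fin 6) : ℤ :=
  (if i < j then 1 else -1) * (if j < k then 1 else -1) * (if i < k then 1 else -1)

theorem chirotope_mul_bracket_pos {v : Fin 6 → Fin 3 → ℝ} (hv : BracketPos v) {i j k : Fin 6}
    (hij : i ≠ j) (hik : i ≠ k) (hjk : j ≠ k) :
    0 < (chirotope i j k : ℝ) * bracket (v i) (v j) (v k) := by
  unfold chirotope
  rcases hij.lt_or_gt with h1 | h1 <;> rcases hjk.lt_or_gt with h2 | h2 <;>
    rcases hik.lt_or_gt with h3 | h3 <;> simp [h1, h2, h3, h1.not_gt, h2.not_gt, h3.not_gt]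
  · exact hv _ _ _ h1 h2
  · exact absurd (h1.trans h2) h3.asymm
  · rw [← neg_pos, ← bracket_swap_right]
    exact hv _ _ _ h3 h2
  · rw [← bracket_rotate, ← bracket_rotate]
    exact hv _ _ _ h3 h1
  · rw [← neg_pos, ← bracket_swap_left]
    exact hv _ _ _ h1 h3
  · rw [← bracket_rotate]
    exact hv _ _ _ h2 h3
  · exact absurd (h2.trans h1) h3.asymm
  · rw [← neg_pos, ← bracket_swap_right, ← bracket_rotate]
    exact hv _ _ _ h2 h1

/-- The sign of this product tells whether, in the pencil of lines through `v e`, the lines to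
`v a` and `v c` separate the lines to `v b` and `v d`. -/
def pencilInv (e a b c d : Fin 6) (v : Fin 6 → Fin 3 → ℝ) : ℝ :=
  bracket (v e) (v a) (v b) * bracket (v e) (v b) (v c) * bracket (v e) (v c) (v d) *
    bracket (v e) (v d) (v a)

/-- The sign of `pencilInv` on a consecutively labeled convex hexagon. -/
def pencilSign (e a b c d : Fin 6) : ℤ :=
  chirotope e a b * chirotope e b c * chirotope e c d * chirotope e d a

theorem pencilSign_mul_pencilInv_pos {v : Fin 6 → Fin 3 → ℝ} (hv : BracketPos v)
    {e a b c d : Fin 6} (h : [e, a, b, c, d].Nodup) :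
    0 < (pencilSign e a b c d : ℝ) * pencilInv e a b c d v := by
  simp at h
  obtain ⟨⟨hea, heb, hec, hed⟩, ⟨hab, hac, had⟩, ⟨hbc, hbd⟩, hcd⟩ := h
  have h1 := chirotope_mul_bracket_pos hv hea heb hab
  have h2 := chirotope_mul_bracket_pos hv heb hec hbc
  have h3 := chirotope_mul_bracket_pos hv hec hed hcd
  have h4 := chirotope_mul_bracket_pos hv hed hea (Ne.symm had)
  have := mul_pos (mul_pos (mul_pos h1 h2) h3) h4
  simp only [pencilSign, pencilInv]
  push_cast
  linarith

theorem pencilSign_adjacent : ∀ i e p q : Fin 6, [e, i, p, i + 1, q].Nodup →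
    pencilSign e i p (i + 1) q = 1 := by
  decide +kernel

theorem exists_pencilSign_of_not_adjacent : ∀ x y : Fin 6, x ≠ y → y ≠ x + 1 → y ≠ x - 1 →
    ∃ e p q : Fin 6, [e, x, p, y, q].Nodup ∧ pencilSign e x p y q = -1 := by
  decide +kernel

theorem RealizedPerm.pencilInv_pos {f : Fin 6 → RP2} {σ : Equiv.Perm (Fin 6)}
    (hσ : RealizedPerm f σ) {v : Fin 6 → Fin 3 → ℝ} (hv : IsLift f v) {e a b c d : Fin 6}
    (hd : [e, a, b, c, d].Nodup) (h : 0 < pencilInv e a b c d v) :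
    0 < pencilInv (σ e) (σ a) (σ b) (σ c) (σ d) v := by
  obtain ⟨γ, hγ, h0, h1⟩ := hσ
  have hv0 : IsLift (fun i => γ i 0) v := by simpa only [h0] using hv
  have hv1 : IsLift (fun i => γ i 1) fun i => v (σ i) := by simpa only [h1] using hv.comp σ
  refine hγ.pos_of_pos (F := pencilInv e a b c d) ?_ ?_ ?_ hv0 hv1 h
  · exact (((continuous_bracket _ _ _).mul (continuous_bracket _ _ _)).mul
      (continuous_bracket _ _ _)).mul (continuous_bracket _ _ _)
  · intro r hr v h
    have e1 : pencilInv e a b c d (fun i => r i • v i) =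
        (r e ^ 2 * r a * r b * r c * r d) ^ 2 * pencilInv e a b c d v := by
      simp only [pencilInv, bracket_smul]; ring
    have := hr e; have := hr a; have := hr b; have := hr c; have := hr d
    rw [e1]
    positivity
  · intro p v hv hp
    have hb := (hv.typicalCfg_iff.1 hp).1
    simp at hd
    obtain ⟨⟨hea, heb, hec, hed⟩, ⟨hab, hac, had⟩, ⟨hbc, hbd⟩, hcd⟩ := hd
    exact mul_ne_zero (mul_ne_zero (mul_ne_zero (hb _ _ _ hea heb hab) (hb _ _ _ heb hec hbc))
      (hb _ _ _ hec hed hcd)) (hb _ _ _ hed hea (Ne.symm had))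

theorem RealizedPerm.adjacent {f : Fin 6 → RP2} {σ : Equiv.Perm (Fin 6)}
    (hσ : RealizedPerm f σ) {v : Fin 6 → Fin 3 → ℝ} (hv : IsLift f v) (hb : BracketPos v)
    (i : Fin 6) : σ (i + 1) = σ i + 1 ∨ σ (i + 1) = σ i - 1 := by
  by_contra! h
  obtain ⟨e, p, q, hd, hs⟩ := exists_pencilSign_of_not_adjacent (σ i) (σ (i + 1))
    (by simp) h.1 h.2
  have hd' : [σ.symm e, i, σ.symm p, i + 1, σ.symm q].Nodup := by
    rw [← List.nodup_map_iff σ.injective]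
    simpa only [List.map, Equiv.apply_symm_apply] using hd
  have h1 := pencilSign_mul_pencilInv_pos hb hd'
  rw [pencilSign_adjacent _ _ _ _ hd', Int.cast_one, one_mul] at h1
  have h2 := hσ.pencilInv_pos hv hd' h1
  have h3 := pencilSign_mul_pencilInv_pos hb hd
  simp only [Equiv.apply_symm_apply] at h2
  rw [hs] at h3
  push_cast at h3
  linarith

/-- A permutation of a hexagon that preserves adjacency is a symmetry of the cyclic order. -/
theorem dihedral_of_adjacent {σ : Equiv.Perm (Fin 6)}
    (h : ∀ i, σ (i + 1) = σ i + 1 ∨ σ (i + 1) = σ i - 1) :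
    (∃ k : Fin 6, ∀ i, σ i = i + k) ∨ (∃ c : Fin 6, ∀ i, σ i = c - i) := by
  have hne : ∀ i, σ (i + 1 + 1) ≠ σ i := fun i h0 => by
    have h1 : ∀ i : Fin 6, i + 1 + 1 ≠ i := by decide
    exact h1 i (σ.injective h0)
  rcases h 0 with h0 | h0
  · have step : ∀ i, σ (i + 1) = σ i + 1 → σ (i + 1 + 1) = σ (i + 1) + 1 := fun i hi =>
      (h (i + 1)).resolve_right fun h2 => hne i (by rw [h2, hi, add_sub_cancel_right])
    have h1 := step _ h0
    have h2 := step _ h1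
    have h3 := step _ h2
    have h4 := step _ h3
    refine Or.inl ⟨σ 0, fun i => ?_⟩
    simp at h0 h1 h2 h3 h4
    fin_cases i <;> simp <;> grind
  · have step : ∀ i, σ (i + 1) = σ i - 1 → σ (i + 1 + 1) = σ (i + 1) - 1 := fun i hi =>
      (h (i + 1)).resolve_left fun h2 => hne i (by rw [h2, hi, sub_add_cancel])
    have h1 := step _ h0
    have h2 := step _ h1
    have h3 := step _ h2
    have h4 := step _ h3
    refine Or.inr ⟨σ 0, fun i => ?_⟩
    simp at h0 h1 h2 h3 h4
    fin_cases i <;> simp <;> grind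

/-- A rotation by an even number of steps, or a reflection `i ↦ c - i` with `c` even. -/
def EvenDihedral (σ : Equiv.Perm (Fin 6)) : Prop :=
  (∃ k : Fin 6, Even (k : ℕ) ∧ ∀ i, σ i = i + k) ∨ (∃ c : Fin 6, Even (c : ℕ) ∧ ∀ i, σ i = c - i)

theorem neg_one_pow_mul_neg_iff {x : ℝ} (hx : x ≠ 0) (n : ℕ) :
    (-1) ^ n * x < 0 ↔ (Even n ↔ x < 0) := by
  rcases n.even_or_odd with h | h
  · simp [h.neg_one_pow, h]
  · simp [h.neg_one_pow, Nat.not_even_iff_odd.2 h, hx.symm.le_iff_lt]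

theorem Fin.even_val_add : ∀ i k : Fin 6,
    Even ((i + k : Fin 6) : ℕ) ↔ (Even (i : ℕ) ↔ Even (k : ℕ)) := by
  decide

theorem Fin.even_val_sub : ∀ i k : Fin 6,
    Even ((i - k : Fin 6) : ℕ) ↔ (Even (i : ℕ) ↔ Even (k : ℕ)) := by
  decide

theorem evenDihedral_iff {f : Fin 6 → RP2} {v : Fin 6 → Fin 3 → ℝ} (hf : IsLift f v)
    (hv : BracketPos v) (hD : conicInv v ≠ 0) (σ : Equiv.Perm (Fin 6)) :
    EvenDihedral σ ↔ ((∃ k : Fin 6, ∀ i, σ i = i + k) ∨ (∃ c : Fin 6, ∀ i, σ i = c - i)) ∧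
      ∀ i, Dominant f i → Dominant f (σ i) := by
  simp only [dominant_iff hf hv hD, neg_one_pow_mul_neg_iff hD]
  have hex : ∃ i : Fin 6, Even (i : ℕ) ↔ conicInv v < 0 := by
    by_cases h : conicInv v < 0
    · exact ⟨0, by simp [h]⟩
    · exact ⟨1, by simp [h]⟩
  constructor
  · rintro (⟨k, hk, h⟩ | ⟨c, hc, h⟩)
    · exact ⟨Or.inl ⟨k, h⟩, fun i hi => by simpa [h, Fin.even_val_add, hk] using hi⟩
    · exact ⟨Or.inr ⟨c, h⟩, fun i hi => by simpa [h, Fin.even_val_sub, hc] using hi⟩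
  · obtain ⟨i, hi⟩ := hex
    rintro ⟨⟨k, h⟩ | ⟨c, h⟩, hdom⟩
    · refine Or.inl ⟨k, ?_, h⟩
      have := hdom i hi
      rw [h, Fin.even_val_add] at this
      tauto
    · refine Or.inr ⟨c, ?_, h⟩
      have := hdom i hi
      rw [h, Fin.even_val_sub] at this
      tauto

theorem conicInv_sub (v : Fin 6 → Fin 3 → ℝ) (c : Fin 6) :
    conicInv (fun i => v (c - i)) = (-1) ^ (c : ℕ) * conicInv v := by
  have h := conicInv_neg fun i => v (i + c)
  rw [conicInv_add] at h
  rw [← h]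
  simp only [neg_add_eq_sub]

theorem even_of_conicInv_pos {x : ℝ} {n : ℕ} (h : 0 < x * ((-1) ^ n * x)) : Even n := by
  by_contra hn
  rw [(Nat.not_even_iff_odd.1 hn).neg_one_pow] at h
  nlinarith [mul_self_nonneg x]

theorem RealizedPerm.evenDihedral {f : Fin 6 → RP2} {σ : Equiv.Perm (Fin 6)}
    (hσ : RealizedPerm f σ) {v : Fin 6 → Fin 3 → ℝ} (hf : IsLift f v) (hv : BracketPos v) :
    EvenDihedral σ := by
  have hpos := hσ.conicInv_pos hf
  rcases dihedral_of_adjacent (hσ.adjacent hf hv) with ⟨k, h⟩ | ⟨c, h⟩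
  · simp only [h, conicInv_add] at hpos
    exact Or.inl ⟨k, even_of_conicInv_pos hpos, h⟩
  · simp only [h, conicInv_sub] at hpos
    exact Or.inr ⟨c, even_of_conicInv_pos hpos, h⟩

/-- The permutations of the hexagon coming from the symmetries of a triangle. -/
def dihedralHom : DihedralGroup 3 →* Equiv.Perm (Fin 6) :=
  MonoidHom.mk' (fun g => match g with
    | .r j => Equiv.addRight (2 * Fin.castLE (by decide) (j : Fin 3))
    | .sr j => Equiv.subLeft (-(2 * Fin.castLE (by decide) (j : Fin 3)))) (by decide)

theorem mem_range_dihedralHom (σ : Equiv.Perm (Fin 6)) :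
    σ ∈ dihedralHom.range ↔ EvenDihedral σ := by
  have hodd : ∀ k : Fin 6, Even (k : ℕ) → ∃ j : Fin 3, k = 2 * Fin.castLE (by decide) j := by
    decide
  constructor
  · rintro ⟨j | j, rfl⟩
    · refine Or.inl ⟨2 * Fin.castLE (by decide) (j : Fin 3), ?_, fun i => rfl⟩
      revert j; decide
    · refine Or.inr ⟨-(2 * Fin.castLE (by decide) (j : Fin 3)), ?_, fun i => rfl⟩
      revert j; decide
  · rintro (⟨k, hk, h⟩ | ⟨c, hc, h⟩)
    · obtain ⟨j, rfl⟩ := hodd k hk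
      exact ⟨.r j, Equiv.ext fun i => (h i).symm⟩
    · obtain ⟨j, hj⟩ := hodd (-c) (by rw [← zero_sub, Fin.even_val_sub]; simpa using hc)
      exact ⟨.sr j, Equiv.ext fun i => by rw [h, ← neg_neg c, hj]; rfl⟩

theorem dihedralHom_injective : Function.Injective dihedralHom := by
  decide

/-- A normal form for six points of the plane, the first four being a projective frame. -/
def normalForm (a b c d : ℝ) : Fin 6 → Fin 3 → ℝ :=
  ![![1, 0, 0], ![0, 1, 0], ![0, 0, 1], ![1, -1, 1], ![1, -a, c], ![1, -b, d]]

theorem bracketPos_normalForm_iff {a b c d : ℝ} : BracketPos (normalForm a b c d) ↔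
    0 < c ∧ 0 < d ∧ 0 < a ∧ 0 < b ∧ c < a ∧ d < b ∧ a * d < c * b ∧ c < 1 ∧ d < 1 ∧ d < c ∧
      a < 1 ∧ b < 1 ∧ b < a ∧ 0 < -(a * d) + c * b - (c - d) + (-b + a) := by
  simp [BracketPos, Fin.forall_fin_succ, bracket, normalForm, and_assoc]

theorem conicInv_normalForm (a b c d : ℝ) : conicInv (normalForm a b c d) =
    b * c * (1 - a) - d * (b * c * (1 - a) + a * (1 - b) * (1 - c)) := by
  simp [conicInv, bracket, normalForm]; ring

/-- For fixed `a`, `b`, `c`, the last parameter of a normal form with negative `conicInv` ranges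
over an open interval. -/
theorem bracketPos_normalForm_and_conicInv_neg_iff {a b c d : ℝ} :
    BracketPos (normalForm a b c d) ∧ conicInv (normalForm a b c d) < 0 ↔
      (0 < b ∧ b < a ∧ a < 1 ∧ 0 < c ∧ c < a) ∧
        b * c * (1 - a) / (b * c * (1 - a) + a * (1 - b) * (1 - c)) < d ∧ d < b * c / a := by
  rw [bracketPos_normalForm_iff, conicInv_normalForm]
  have hQ : 0 < b → b < a → a < 1 → 0 < c → c < a →
      0 < b * c * (1 - a) + a * (1 - b) * (1 - c) := fun h1 h2 h3 h4 h5 => by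
    have := sub_pos.2 h3
    have := sub_pos.2 (h2.trans h3)
    have := sub_pos.2 (h5.trans h3)
    have := h1.trans h2
    positivity
  constructor
  · rintro ⟨⟨h1, h2, h3, h4, h5, h6, h7, h8, h9, h10, h11, h12, h13, h14⟩, h15⟩
    refine ⟨⟨h4, h13, h11, h1, h5⟩, ?_, ?_⟩
    · rw [div_lt_iff₀ (hQ h4 h13 h11 h1 h5)]
      linarith
    · rw [lt_div_iff₀ h3]
      linarith
  · rintro ⟨⟨hb, hba, ha1, hc, hca⟩, hlo, hhi⟩
    have hQ := hQ hb hba ha1 hc hca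
    have ha := hb.trans hba
    have hd : 0 < d := lt_trans (by have := sub_pos.2 ha1; positivity) hlo
    rw [div_lt_iff₀ hQ] at hlo
    rw [lt_div_iff₀ ha] at hhi
    have hdb : d < b := lt_of_mul_lt_mul_left (by nlinarith : a * d < a * b) ha.le
    have hdc : d < c := lt_of_mul_lt_mul_left (by nlinarith : a * d < a * c) ha.le
    refine ⟨⟨hc, hd, ha, hb, hca, hdb, by linarith, hca.trans ha1, hdc.trans (hca.trans ha1), hdc,
      ha1, hba.trans ha1, hba, ?_⟩, by linarith⟩
    refine pos_of_mul_pos_right (b := _) (a := b * c * (1 - a) + a * (1 - b) * (1 - c)) ?_ hQ.le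
    have k1 := mul_pos (mul_pos (sub_pos.2 (hba.trans ha1)) (sub_pos.2 (hca.trans ha1)))
      (mul_pos (sub_pos.2 hba) (sub_pos.2 hca))
    have k2 := mul_pos (sub_pos.2 ha1) (sub_pos.2 hlo)
    linarith

/-- The normal forms with positive brackets and negative `conicInv` form a path connected set. -/
theorem isPathConnected_normalForm : IsPathConnected {v | ∃ a b c d, v = normalForm a b c d ∧
    BracketPos v ∧ conicInv v < 0} := by
  let T : Set (ℝ × ℝ × ℝ × ℝ) := {p | 0 < p.2.1 ∧ p.2.1 < p.1 ∧ p.1 < 1 ∧ 0 < p.2.2.1 ∧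
    p.2.2.1 < p.1 ∧ 0 < p.2.2.2 ∧ p.2.2.2 < 1}
  have hT : IsPathConnected T := by
    refine Convex.isPathConnected ?_ ⟨(1 / 2, 1 / 4, 1 / 4, 1 / 2), ?_⟩
    · rintro ⟨a, b, c, s⟩ ⟨h1, h2, h3, h4, h5, h6, h7⟩ ⟨a', b', c', s'⟩
        ⟨h1', h2', h3', h4', h5', h6', h7'⟩ x y hx hy hxy
      simp only at *
      have key : ∀ {p p' : ℝ}, 0 < p → 0 < p' → 0 < x * p + y * p' := fun {p p'} hp hp' => by
        rcases hx.eq_or_lt with rfl | hx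
        · simp at hxy; simp [hxy, hp']
        · have := mul_nonneg hy hp'.le
          have := mul_pos hx hp
          linarith
      have k2 := key (sub_pos.2 h2) (sub_pos.2 h2')
      have k3 := key (sub_pos.2 h3) (sub_pos.2 h3')
      have k5 := key (sub_pos.2 h5) (sub_pos.2 h5')
      have k7 := key (sub_pos.2 h7) (sub_pos.2 h7')
      refine ⟨key h1 h1', ?_, ?_, key h4 h4', ?_, key h6 h6', ?_⟩ <;> simp <;> linarith
    · simp only [T, Set.mem_ofPred_eq]; norm_num
  let lo : ℝ → ℝ → ℝ → ℝ := fun a b c =>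
    b * c * (1 - a) / (b * c * (1 - a) + a * (1 - b) * (1 - c))
  let hi : ℝ → ℝ → ℝ → ℝ := fun a b c => b * c / a
  have hlohi : ∀ a b c, 0 < b → b < a → a < 1 → 0 < c → c < a → 0 < a ∧
      0 < b * c * (1 - a) + a * (1 - b) * (1 - c) ∧ lo a b c < hi a b c := by
    intro a b c hb hba ha1 hc hca
    have h1 := sub_pos.2 ha1
    have h2 := sub_pos.2 (hba.trans ha1)
    have h3 := sub_pos.2 (hca.trans ha1)
    have ha := hb.trans hba
    have hQ : 0 < b * c * (1 - a) + a * (1 - b) * (1 - c) := by positivity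
    refine ⟨ha, hQ, ?_⟩
    simp only [lo, hi]
    rw [div_lt_div_iff₀ hQ ha]
    have := mul_pos (mul_pos hb hc) (mul_pos (sub_pos.2 hba) (sub_pos.2 hca))
    linarith
  have himage := hT.image' (f := fun p : ℝ × ℝ × ℝ × ℝ => normalForm p.1 p.2.1 p.2.2.1
    (lo p.1 p.2.1 p.2.2.1 + p.2.2.2 * (hi p.1 p.2.1 p.2.2.1 - lo p.1 p.2.1 p.2.2.1))) ?_
  · convert himage using 1
    ext v
    constructor
    · rintro ⟨a, b, c, d, rfl, hv⟩
      obtain ⟨⟨hb, hba, ha1, hc, hca⟩, hlo, hhi⟩ :=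
        bracketPos_normalForm_and_conicInv_neg_iff.1 hv
      have h := sub_pos.2 (hlohi a b c hb hba ha1 hc hca).2.2
      refine ⟨(a, b, c, (d - lo a b c) / (hi a b c - lo a b c)),
        ⟨hb, hba, ha1, hc, hca, div_pos (sub_pos.2 hlo) h, ?_⟩, ?_⟩
      · rw [div_lt_one h]
        exact sub_lt_sub_right hhi _
      · simp only
        rw [div_mul_cancel₀ _ h.ne', add_sub_cancel]
    · rintro ⟨⟨a, b, c, s⟩, ⟨hb, hba, ha1, hc, hca, hs, hs1⟩, rfl⟩
      refine ⟨_, _, _, _, rfl, bracketPos_normalForm_and_conicInv_neg_iff.2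
        ⟨⟨hb, hba, ha1, hc, hca⟩, ?_⟩⟩
      simp only at *
      have h := sub_pos.2 (hlohi a b c hb hba ha1 hc hca).2.2
      have h1 := mul_pos hs h
      have h2 := mul_pos (sub_pos.2 hs1) h
      change lo a b c < _ ∧ _ < hi a b c
      constructor <;> linarith
  · have hcont : Continuous fun q : ℝ × ℝ × ℝ × ℝ => normalForm q.1 q.2.1 q.2.2.1 q.2.2.2 := by
      refine continuous_pi fun i => continuous_pi fun j => ?_
      fin_cases i <;> fin_cases j <;> simp [normalForm] <;> fun_prop
    have hhi : ContinuousOn (fun p : ℝ × ℝ × ℝ × ℝ => hi p.1 p.2.1 p.2.2.1) T := by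
      refine ContinuousOn.div (by fun_prop) (by fun_prop) ?_
      rintro ⟨a, b, c, s⟩ ⟨hb, hba, ha1, hc, hca, hs, hs1⟩
      exact (hlohi a b c hb hba ha1 hc hca).1.ne'
    have hlo : ContinuousOn (fun p : ℝ × ℝ × ℝ × ℝ => lo p.1 p.2.1 p.2.2.1) T := by
      refine ContinuousOn.div (by fun_prop) (by fun_prop) ?_
      rintro ⟨a, b, c, s⟩ ⟨hb, hba, ha1, hc, hca, hs, hs1⟩
      exact (hlohi a b c hb hba ha1 hc hca).2.1.ne'
    exact hcont.comp_continuousOn (f := fun p : ℝ × ℝ × ℝ × ℝ => (p.1, p.2.1, p.2.2.1,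
      lo p.1 p.2.1 p.2.2.1 + p.2.2.2 * (hi p.1 p.2.1 p.2.2.1 - lo p.1 p.2.1 p.2.2.1)))
      (continuousOn_fst.prodMk <| ContinuousOn.prodMk (by fun_prop) <| ContinuousOn.prodMk
        (by fun_prop) <| hlo.add <| ContinuousOn.mul (by fun_prop) <| hhi.sub hlo)

/-- Every configuration of six vectors with positive brackets is obtained from a normal form. -/
theorem BracketPos.exists_normalForm {v : Fin 6 → Fin 3 → ℝ} (hv : BracketPos v) :
    ∃ (M : Matrix (Fin 3) (Fin 3) ℝ) (r : Fin 6 → ℝ) (a b c d : ℝ), 0 < M.det ∧ (∀ i, 0 < r i) ∧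
      v = fun i => r i • M.mulVec (normalForm a b c d i) := by
  have hδ : 0 < bracket (v 0) (v 1) (v 2) := hv 0 1 2 (by decide) (by decide)
  obtain ⟨M, n, hM, hvn, h0, h1, h2⟩ := exists_frame hδ.ne'
  rw [← hM] at hδ
  have hn : BracketPos n := fun i j k hij hjk => by
    have := hv i j k hij hjk
    rw [hvn, hvn, hvn, bracket_mulVec] at this
    exact pos_of_mul_pos_right this hδ.le
  have x3 := hn 1 2 3 (by decide) (by decide)
  have x4 := hn 1 2 4 (by decide) (by decide)
  have x5 := hn 1 2 5 (by decide) (by decide)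
  have y3 := hn 0 2 3 (by decide) (by decide)
  have z3 := hn 0 1 3 (by decide) (by decide)
  simp [bracket, h0, h1, h2] at x3 x4 x5 y3 z3
  refine ⟨M * Matrix.diagonal ![n 3 0, -n 3 1, n 3 2],
    ![1 / n 3 0, 1 / (-n 3 1), 1 / n 3 2, 1, n 4 0 / n 3 0, n 5 0 / n 3 0],
    -(n 4 1 / -n 3 1 / (n 4 0 / n 3 0)), -(n 5 1 / -n 3 1 / (n 5 0 / n 3 0)),
    n 4 2 / n 3 2 / (n 4 0 / n 3 0), n 5 2 / n 3 2 / (n 5 0 / n 3 0), ?_, ?_, ?_⟩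
  · rw [Matrix.det_mul, Matrix.det_diagonal, Fin.prod_univ_three]
    have := neg_pos.2 y3
    simp only [Matrix.cons_val]
    positivity
  · have := neg_pos.2 y3
    intro i
    fin_cases i <;> simp only [Fin.reduceFinMk, Fin.zero_eta, Fin.mk_one, Matrix.cons_val] <;>
      positivity
  · ext1 i
    rw [hvn, ← Matrix.mulVec_mulVec, ← Matrix.mulVec_smul]
    congr 1
    have := y3.ne
    ext j
    rw [Pi.smul_apply, Matrix.mulVec_diagonal]
    fin_cases i <;> fin_cases j <;> simp [normalForm, h0, h1, h2] <;> field_simp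

theorem BracketPos.smul_mulVec_iff {v : Fin 6 → Fin 3 → ℝ} {M : Matrix (Fin 3) (Fin 3) ℝ}
    {r : Fin 6 → ℝ} (hM : 0 < M.det) (hr : ∀ i, 0 < r i) :
    BracketPos (fun i => r i • M.mulVec (v i)) ↔ BracketPos v := by
  refine forall₃_congr fun i j k => forall₂_congr fun _ _ => ?_
  have := mul_pos (mul_pos (hr i) (hr j)) (hr k)
  rw [bracket_smul, bracket_mulVec, mul_pos_iff_of_pos_left this, mul_pos_iff_of_pos_left hM]

theorem conicInv_smul_mulVec_neg_iff {v : Fin 6 → Fin 3 → ℝ} {M : Matrix (Fin 3) (Fin 3) ℝ}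
    {r : Fin 6 → ℝ} (hM : 0 < M.det) (hr : ∀ i, 0 < r i) :
    conicInv (fun i => r i • M.mulVec (v i)) < 0 ↔ conicInv v < 0 := by
  have := Finset.prod_pos fun i (_ : i ∈ Finset.univ) => hr i
  rw [← neg_pos, ← neg_pos (a := conicInv v), conicInv_smul, conicInv_mulVec, ← mul_neg, ← mul_neg,
    mul_pos_iff_of_pos_left (by positivity), mul_pos_iff_of_pos_left (by positivity)]

theorem isPathConnected_bracketPos_conicInv_neg :
    IsPathConnected {v : Fin 6 → Fin 3 → ℝ | BracketPos v ∧ conicInv v < 0} := by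
  have hr : IsPathConnected {r : Fin 6 → ℝ | ∀ i, 0 < r i} := by
    have := IsPathConnected.pi fun _ : Fin 6 => (convex_Ioi (0 : ℝ)).isPathConnected ⟨1, zero_lt_one' ℝ⟩
    convert this using 1
    ext r
    simp
  have h := (isPathConnected_det_pos.prod (hr.prod isPathConnected_normalForm)).image
    (f := fun p : Matrix (Fin 3) (Fin 3) ℝ × (Fin 6 → ℝ) × (Fin 6 → Fin 3 → ℝ) =>
      fun i => p.2.1 i • p.1.mulVec (p.2.2 i)) (by fun_prop)
  convert h using 1
  ext v
  constructor
  · rintro ⟨hv, hD⟩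
    obtain ⟨M, r, a, b, c, d, hM, hr, rfl⟩ := hv.exists_normalForm
    exact ⟨(M, r, _), ⟨hM, hr, a, b, c, d, rfl, (BracketPos.smul_mulVec_iff hM hr).1 hv,
      (conicInv_smul_mulVec_neg_iff hM hr).1 hD⟩, rfl⟩
  · rintro ⟨⟨M, r, w⟩, ⟨hM, hr, a, b, c, d, -, hw, hD⟩, rfl⟩
    exact ⟨(BracketPos.smul_mulVec_iff hM hr).2 hw, (conicInv_smul_mulVec_neg_iff hM hr).2 hD⟩

theorem JoinedIn.realizedPerm {f : Fin 6 → RP2} {v w : Fin 6 → Fin 3 → ℝ}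
    {σ : Equiv.Perm (Fin 6)} (hf : IsLift f v) (hw : IsLift (fun i => f (σ i)) w)
    (h : JoinedIn {v : Fin 6 → Fin 3 → ℝ | BracketPos v ∧ conicInv v < 0} v w) :
    RealizedPerm f σ := by
  obtain ⟨p, hp⟩ := h
  have hb : ∀ t i j k, i ≠ j → i ≠ k → j ≠ k → bracket (p t i) (p t j) (p t k) ≠ 0 :=
    fun t i j k => bracket_ne_zero_of_pos (hp t).1
  have h0 : ∀ i t, p t i ≠ 0 := fun i t h0 =>
    hb t i (i + 1) (i + 2) (by simp) (by simp) (by simp) (by simp [h0, bracket])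
  refine ⟨fun i t => Projectivization.mk ℝ (p t i) (h0 i t), ⟨fun i => ?_, fun t => ?_⟩,
    fun i => ?_, fun i => ?_⟩
  · exact continuous_mk ((continuous_apply i).comp p.continuous) _
  · exact (isLift_mk fun i => h0 i t).typicalCfg_iff.2 ⟨hb t, (hp t).2.ne⟩
  · simp only [p.source]
    exact hf.mk_eq i
  · simp only [p.target]
    exact hw.mk_eq i

theorem EvenDihedral.realizedPerm_of_neg {f : Fin 6 → RP2} {v : Fin 6 → Fin 3 → ℝ}
    {σ : Equiv.Perm (Fin 6)} (hσ : EvenDihedral σ) (hf : IsLift f v) (hv : BracketPos v)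
    (hD : conicInv v < 0) : RealizedPerm f σ := by
  rcases hσ with ⟨k, hk, h⟩ | ⟨c, hc, h⟩
  · refine JoinedIn.realizedPerm hf (hf.comp σ)
      (isPathConnected_bracketPos_conicInv_neg.joinedIn _ ⟨hv, hD⟩ _ ?_)
    simp only [h]
    refine ⟨bracketPos_add hv k, ?_⟩
    rwa [conicInv_add, hk.neg_one_pow, one_mul]
  · refine JoinedIn.realizedPerm hf ((hf.comp σ).const_smul (neg_ne_zero.2 one_ne_zero))
      (isPathConnected_bracketPos_conicInv_neg.joinedIn _ ⟨hv, hD⟩ _ ?_)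
    simp only [h]
    refine ⟨?_, ?_⟩
    · simpa only [neg_add_eq_sub] using bracketPos_neg (bracketPos_add hv c)
    · rw [conicInv_smul, conicInv_sub, hc.neg_one_pow]
      norm_num
      exact hD

theorem TypicalCfg.comp {n : ℕ} {f : Fin n → RP2} (hf : TypicalCfg f) {s : Fin n → Fin n}
    (hs : Function.Injective s) : TypicalCfg fun i => f (s i) :=
  ⟨⟨hf.1.1.comp hs, fun _ _ _ hij hik hjk => hf.1.2 _ _ _ (hs.ne hij) (hs.ne hik) (hs.ne hjk)⟩,
    fun g hg => hf.2 (s ∘ g) (hs.comp hg)⟩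

theorem EvenDihedral.realizedPerm {f : Fin 6 → RP2} {v : Fin 6 → Fin 3 → ℝ}
    {σ : Equiv.Perm (Fin 6)} (hσ : EvenDihedral σ) (hf : IsLift f v) (hv : BracketPos v)
    (hD : conicInv v ≠ 0) : RealizedPerm f σ := by
  rcases hD.lt_or_gt with hD | hD
  · exact hσ.realizedPerm_of_neg hf hv hD
  · set τ : Equiv.Perm (Fin 6) := ((Equiv.addRight 1).trans σ).trans (Equiv.subRight 1) with hτ
    have hτ' : ∀ i, τ i = σ (i + 1) - 1 := fun i => rfl
    have hτe : EvenDihedral τ := by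
      rcases hσ with ⟨k, hk, h⟩ | ⟨c, hc, h⟩
      · exact Or.inl ⟨k, hk, fun i => by rw [hτ', h]; abel⟩
      · exact Or.inr ⟨c - 1 - 1, by simpa [Fin.even_val_sub] using hc,
          fun i => by rw [hτ', h]; abel⟩
    obtain ⟨γ, hγ, h0, h1⟩ := hτe.realizedPerm_of_neg (hf.comp fun i => i + 1)
      (bracketPos_add_one hv) (by rw [conicInv_add_one]; exact neg_neg_of_pos hD)
    refine ⟨fun i => γ (i - 1), ⟨fun i => hγ.1 _, fun t => (hγ.2 t).comp sub_left_injective⟩,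
      fun i => ?_, fun i => ?_⟩
    · simp [h0]
    · simp [h1, hτ']

/-- For a hexagonal typical 6-configuration with consecutive cyclic labeling, a permutation
is realized by a Q-deformation loop iff it is a symmetry of the cyclic order (a rotation or a
reflection) preserving dominance; in particular the realized permutations form a group
isomorphic to the dihedral group `D₃` of order 6. -/
theorem monodromy_group_hexagonal (f : Fin 6 → RP2)
    (hf : TypicalCfg f) (hconv : ConsecConvexPos f) :
    (∀ σ : Equiv.Perm (Fin 6),
      RealizedPerm f σ ↔
        (((∃ k : Fin 6, ∀ i, σ i = i + k) ∨ (∃ c : Fin 6, ∀ i, σ i = c - i)) ∧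
          ∀ i, Dominant f i → Dominant f (σ i))) ∧
    ∃ G : Subgroup (Equiv.Perm (Fin 6)),
      (∀ σ, σ ∈ G ↔ RealizedPerm f σ) ∧ Nonempty (G ≃* DihedralGroup 3) := by
  obtain ⟨v, hv, hb⟩ := hconv.exists_isLift hf
  have hD := (hv.typicalCfg_iff.1 hf).2
  have hreal : ∀ σ, RealizedPerm f σ ↔ EvenDihedral σ := fun σ =>
    ⟨fun h => h.evenDihedral hv hb, fun h => h.realizedPerm hv hb hD⟩
  refine ⟨fun σ => (hreal σ).trans (evenDihedral_iff hv hb hD σ), dihedralHom.range, fun σ => ?_,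
    ⟨(MonoidHom.ofInjective dihedralHom_injective).symm⟩⟩
  rw [hreal, mem_range_dihedralHom]

end
end

section
/- For every heptagonal typical 7-configuration P there exists a numeration p₀,…,p₆ of its points, consecutive in the cyclic order given by convex position, such that d(p_k) = k for odd k and d(p_k) = 6 − k for even k; that is, the sequence (d(p₀), d(p₁), …, d(p₆)) equals (6, 1, 4, 3, 2, 5, 0). -/
open scoped LinearAlgebra.Projectivization
open Projectivization

noncomputable section

/-- `f i` lies outside every conic through the five points of the 7-configuration other
than `f i` and `f j`. -/
def OutAll (f : Fin 7 → RP2) (i j : Fin 7) : Prop :=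
  ∀ q : QuadraticForm ℝ (Fin 3 → ℝ), q ≠ 0 → (∀ k, k ≠ i → k ≠ j → q ((f k).rep) = 0) →
    OutsideConic q (f i)

open Classical in
/-- `d_{i,j}` equals 1 if `f i` lies outside every conic through the five remaining points,
and 0 otherwise (i.e. if it lies inside every such conic). -/
def dIdx (f : Fin 7 → RP2) (i j : Fin 7) : ℕ :=
  if OutAll f i j then 1 else 0

/-- The dominance index `d(p_i) = Σ_{j ≠ i} d_{i,j}`. -/
def domIdx (f : Fin 7 → RP2) (i : Fin 7) : ℕ :=
  ∑ j ∈ Finset.univ.erase i, dIdx f i j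

/-- The determinant of three vectors of `ℝ³`. -/
def det3 (a b c : Fin 3 → ℝ) : ℝ :=
  a 0 * (b 1 * c 2 - b 2 * c 1) - a 1 * (b 0 * c 2 - b 2 * c 0) + a 2 * (b 0 * c 1 - b 1 * c 0)

theorem det3_cycle (a b c : Fin 3 → ℝ) : det3 b c a = det3 a b c := by
  unfold det3; ring

theorem det3_swap (a b c : Fin 3 → ℝ) : det3 b a c = -det3 a b c := by
  unfold det3; ring

theorem det3_swap_right (a b c : Fin 3 → ℝ) : det3 a c b = -det3 a b c := by
  unfold det3; ring

theorem det3_neg (a b c : Fin 3 → ℝ) : det3 (-a) (-b) (-c) = -det3 a b c := by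
  simp only [det3, Pi.neg_apply]; ring

theorem det3_plucker (a b c d x : Fin 3 → ℝ) :
    det3 a b x * det3 c d x - det3 a c x * det3 b d x + det3 a d x * det3 b c x = 0 := by
  unfold det3; ring

theorem det3_cramer (a b c w : Fin 3 → ℝ) :
    det3 a b c • w = det3 w b c • a + det3 a w c • b + det3 a b w • c := by
  funext i
  fin_cases i <;> simp [det3] <;> ring

/-- The determinant of three vectors as a linear form in the last one. -/
def det3Lin (a b : Fin 3 → ℝ) : (Fin 3 → ℝ) →ₗ[ℝ] ℝ where
  toFun := det3 a b
  map_add' x y := by simp only [det3, Pi.add_apply]; ring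
  map_smul' r x := by simp only [det3, Pi.smul_apply, smul_eq_mul, RingHom.id_apply]; ring

@[simp] theorem det3Lin_apply (a b x : Fin 3 → ℝ) : det3Lin a b x = det3 a b x := rfl

theorem det3_ne_zero_of_linearIndependent {a b c : Fin 3 → ℝ}
    (h : LinearIndependent ℝ ![a, b, c]) : det3 a b c ≠ 0 := by
  have h1 : LinearIndependent ℝ (Matrix.of ![a, b, c]).row := h
  rw [Matrix.linearIndependent_rows_iff_isUnit, Matrix.isUnit_iff_isUnit_det,
    Matrix.det_fin_three] at h1
  have h2 := h1.ne_zero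
  simp only [Matrix.of_apply, Matrix.cons_val] at h2
  intro h3
  apply h2
  rw [← h3]
  unfold det3
  ring

theorem det3_smul (r s t : ℝ) (a b c : Fin 3 → ℝ) :
    det3 (r • a) (s • b) (t • c) = r * s * t * det3 a b c := by
  simp only [det3, Pi.smul_apply, smul_eq_mul]; ring

/-- The alternating polynomial in six vectors of `ℝ³` which vanishes exactly when the six
corresponding points are coconic. -/
def hexDet (a b c d e f : Fin 3 → ℝ) : ℝ :=
  det3 a b e * det3 c d e * (det3 a c f * det3 b d f) -
    det3 a c e * det3 b d e * (det3 a b f * det3 c d f)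

theorem hexDet_swap₀₁ (a b c d e f : Fin 3 → ℝ) :
    hexDet b a c d e f = -hexDet a b c d e f := by
  have he := det3_plucker a b c d e
  have hf := det3_plucker a b c d f
  unfold hexDet
  rw [det3_swap a b e, det3_swap a b f]
  linear_combination det3 a b f * det3 c d f * he - det3 a b e * det3 c d e * hf

theorem hexDet_swap₁₂ (a b c d e f : Fin 3 → ℝ) :
    hexDet a c b d e f = -hexDet a b c d e f := by
  unfold hexDet; ring

theorem hexDet_swap₂₃ (a b c d e f : Fin 3 → ℝ) :
    hexDet a b d c e f = -hexDet a b c d e f := by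
  have he := det3_plucker a b c d e
  have hf := det3_plucker a b c d f
  unfold hexDet
  rw [det3_swap c d e, det3_swap c d f]
  linear_combination det3 a b f * det3 c d f * he - det3 a b e * det3 c d e * hf

theorem hexDet_swap₃₄ (a b c d e f : Fin 3 → ℝ) :
    hexDet a b c e d f = -hexDet a b c d e f := by
  have h1 : det3 a b e * det3 b d f - det3 a b d * det3 b e f = det3 a b f * det3 b d e := by
    unfold det3; ring
  have h2 : det3 a c e * det3 c d f - det3 a c d * det3 c e f = det3 a c f * det3 c d e := by
    unfold det3; ring
  unfold hexDet
  rw [det3_swap_right c d e, det3_swap_right b d e]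
  linear_combination det3 c d e * det3 a c f * h1 - det3 b d e * det3 a b f * h2

theorem hexDet_swap₄₅ (a b c d e f : Fin 3 → ℝ) :
    hexDet a b c d f e = -hexDet a b c d e f := by
  unfold hexDet; ring

theorem hexDet_rotate (a b c d e f : Fin 3 → ℝ) :
    hexDet b c d e f a = -hexDet a b c d e f := by
  rw [hexDet_swap₄₅, hexDet_swap₃₄, hexDet_swap₂₃, hexDet_swap₁₂, hexDet_swap₀₁]
  ring

theorem hexDet_reverse (a b c d e f : Fin 3 → ℝ) :
    hexDet f e d c b a = -hexDet a b c d e f := by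
  conv_lhs =>
    rw [hexDet_swap₀₁, hexDet_swap₁₂, hexDet_swap₂₃, hexDet_swap₃₄, hexDet_swap₄₅,
      hexDet_swap₀₁, hexDet_swap₁₂, hexDet_swap₂₃, hexDet_swap₃₄,
      hexDet_swap₀₁, hexDet_swap₁₂, hexDet_swap₂₃, hexDet_swap₀₁, hexDet_swap₁₂, hexDet_swap₀₁]
  ring

theorem hexDet_neg (a b c d e f : Fin 3 → ℝ) :
    hexDet (-a) (-b) (-c) (-d) (-e) (-f) = hexDet a b c d e f := by
  simp only [hexDet, det3_neg]; ring

/-- Both generators of the pencil of conics through `a, b, c, d` give such a relation; this is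
the one given by the pair of lines `ab`, `cd`. -/
theorem hexDet_relation (a b c d e f g : Fin 3 → ℝ) :
    det3 a b e * det3 c d e * hexDet a b c d f g - det3 a b f * det3 c d f * hexDet a b c d e g +
      det3 a b g * det3 c d g * hexDet a b c d e f = 0 := by
  unfold hexDet; ring

/-- The quadratic form `x ↦ hexDet a b c d e x`. -/
def hexForm (a b c d e : Fin 3 → ℝ) : QuadraticForm ℝ (Fin 3 → ℝ) :=
  (det3 a b e * det3 c d e) • QuadraticMap.linMulLin (det3Lin a c) (det3Lin b d) -
    (det3 a c e * det3 b d e) • QuadraticMap.linMulLin (det3Lin a b) (det3Lin c d)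

theorem hexForm_apply (a b c d e x : Fin 3 → ℝ) : hexForm a b c d e x = hexDet a b c d e x := by
  simp [hexForm, hexDet]

/-- Vectors of `ℝ³` representing the vertices of a convex polygon in counterclockwise order. -/
def PosOriented {n : ℕ} (v : Fin n → Fin 3 → ℝ) : Prop :=
  ∀ i j k : Fin n, i < j → j < k → 0 < det3 (v i) (v j) (v k)

theorem PosOriented.comp {m n : ℕ} {v : Fin n → Fin 3 → ℝ} (hv : PosOriented v)
    {g : Fin m → Fin n} (hg : StrictMono g) : PosOriented (v ∘ g) :=
  fun _ _ _ hij hjk => hv _ _ _ (hg hij) (hg hjk)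

theorem PosOriented.rotate {n : ℕ} {v : Fin (n + 1) → Fin 3 → ℝ} (hv : PosOriented v) :
    PosOriented (fun i => v (i + 1)) := by
  have key : ∀ i j : Fin (n + 1), i < j → i < i + 1 ∧ (j ≠ Fin.last n → i + 1 < j + 1) := by
    intro i j hij
    have hi : i < Fin.last n := lt_of_lt_of_le hij (Fin.le_last j)
    refine ⟨Fin.lt_add_one_iff.2 hi, fun hj => ?_⟩
    have hj' : j < Fin.last n := lt_of_le_of_ne (Fin.le_last j) hj
    rw [Fin.lt_def, Fin.val_add_one_of_lt hi, Fin.val_add_one_of_lt hj']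
    exact Nat.succ_lt_succ hij
  intro i j k hij hjk
  have hj : j ≠ Fin.last n := (lt_of_lt_of_le hjk (Fin.le_last k)).ne
  by_cases hk : k = Fin.last n
  · subst hk
    simp only [Fin.last_add_one]
    rw [det3_cycle]
    exact hv _ _ _ (lt_of_le_of_lt (Fin.zero_le i) (key i j hij).1) ((key i j hij).2 hj)
  · exact hv _ _ _ ((key i j hij).2 hj) ((key j k hjk).2 hk)

theorem PosOriented.neg_rev {n : ℕ} {v : Fin n → Fin 3 → ℝ} (hv : PosOriented v) :
    PosOriented (fun i => -v i.rev) := by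
  intro i j k hij hjk
  have := hv _ _ _ (Fin.rev_lt_rev.2 hjk) (Fin.rev_lt_rev.2 hij)
  rwa [det3_neg, ← det3_swap, ← det3_cycle, ← det3_cycle]

theorem hexForm_ne_zero {u : Fin 5 → Fin 3 → ℝ} (hu : PosOriented u) :
    hexForm (u 0) (u 1) (u 2) (u 3) (u 4) ≠ 0 := by
  intro h
  have h1 := hexForm_apply (u 0) (u 1) (u 2) (u 3) (u 4) (u 0 + u 1)
  rw [h] at h1
  have h2 : hexDet (u 0) (u 1) (u 2) (u 3) (u 4) (u 0 + u 1) =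
      -(det3 (u 0) (u 1) (u 4) * det3 (u 2) (u 3) (u 4) *
        (det3 (u 0) (u 1) (u 2) * det3 (u 0) (u 1) (u 3))) := by
    unfold hexDet
    have e1 : det3 (u 0) (u 1) (u 0 + u 1) = 0 := by simp only [det3, Pi.add_apply]; ring
    have e2 : det3 (u 0) (u 2) (u 0 + u 1) = -det3 (u 0) (u 1) (u 2) := by
      simp only [det3, Pi.add_apply]; ring
    have e3 : det3 (u 1) (u 3) (u 0 + u 1) = det3 (u 0) (u 1) (u 3) := by
      simp only [det3, Pi.add_apply]; ring
    rw [e1, e2, e3]; ring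
  have a1 := hu 0 1 4 (by decide) (by decide)
  have a2 := hu 2 3 4 (by decide) (by decide)
  have a3 := hu 0 1 2 (by decide) (by decide)
  have a4 := hu 0 1 3 (by decide) (by decide)
  have h3 : hexDet (u 0) (u 1) (u 2) (u 3) (u 4) (u 0 + u 1) < 0 := by
    rw [h2, neg_lt_zero]; positivity
  exact h3.ne h1.symm

theorem hexForm_apply_eq_zero (u : Fin 5 → Fin 3 → ℝ) (i : Fin 5) :
    hexForm (u 0) (u 1) (u 2) (u 3) (u 4) (u i) = 0 := by
  rw [hexForm_apply]
  fin_cases i <;> simp [hexDet, det3] <;> ring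

section Conics

variable {q : QuadraticForm ℝ (Fin 3 → ℝ)} {a b c : Fin 3 → ℝ}

theorem quadraticForm_apply_three (hqa : q a = 0) (hqb : q b = 0) (hqc : q c = 0) (u v t : ℝ) :
    q (u • a + v • b + t • c) =
      u * v * QuadraticMap.polar q a b + u * t * QuadraticMap.polar q a c +
        v * t * QuadraticMap.polar q b c := by
  rw [QuadraticMap.map_add q (u • a + v • b), QuadraticMap.map_add q (u • a)]
  simp only [QuadraticMap.map_smul, QuadraticMap.polar_add_left, QuadraticMap.polar_smul_left,
    QuadraticMap.polar_smul_right, hqa, hqb, hqc, smul_eq_mul]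
  ring

theorem det3_sq_mul_quadraticForm (hqa : q a = 0) (hqb : q b = 0) (hqc : q c = 0)
    (w : Fin 3 → ℝ) :
    det3 a b c ^ 2 * q w =
      det3 w b c * det3 a w c * QuadraticMap.polar q a b +
        det3 w b c * det3 a b w * QuadraticMap.polar q a c +
        det3 a w c * det3 a b w * QuadraticMap.polar q b c := by
  rw [← quadraticForm_apply_three hqa hqb hqc, ← det3_cramer, QuadraticMap.map_smul, smul_eq_mul]
  ring

theorem eq_zero_of_det3_eq_zero (hd : det3 a b c ≠ 0) {w : Fin 3 → ℝ} (h1 : det3 w b c = 0)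
    (h2 : det3 a w c = 0) (h3 : det3 a b w = 0) : w = 0 := by
  have h := det3_cramer a b c w
  rw [h1, h2, h3] at h
  simpa [hd] using h

theorem eq_zero_of_orthogonal {α β γ u v t : ℝ} (h : α * β + α * γ + β * γ < 0)
    (hq : u * v + u * t + v * t = 0)
    (hl : (α ^ 2 + β ^ 2 + γ ^ 2) * (u + v + t) =
      (α + β + γ) * (α * u + β * v + γ * t)) : u = 0 ∧ v = 0 ∧ t = 0 := by
  set N := α ^ 2 + β ^ 2 + γ ^ 2 with hN
  have hS : (α + β + γ) ^ 2 < N := by rw [hN]; nlinarith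
  have hN0 : 0 < N := lt_of_le_of_lt (sq_nonneg _) hS
  have hT : (u + v + t) ^ 2 = u ^ 2 + v ^ 2 + t ^ 2 := by linear_combination 2 * hq
  have hC : (α * u + β * v + γ * t) ^ 2 ≤ N * (u + v + t) ^ 2 := by
    rw [hT, hN]
    nlinarith [sq_nonneg (α * v - β * u), sq_nonneg (α * t - γ * u), sq_nonneg (β * t - γ * v)]
  have h1 : N ^ 2 * (u + v + t) ^ 2 ≤ (α + β + γ) ^ 2 * (N * (u + v + t) ^ 2) := by
    calc N ^ 2 * (u + v + t) ^ 2 = (α + β + γ) ^ 2 * (α * u + β * v + γ * t) ^ 2 := by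
          rw [← mul_pow, ← mul_pow, hl]
      _ ≤ _ := mul_le_mul_of_nonneg_left hC (sq_nonneg _)
  have h2 : (u + v + t) ^ 2 ≤ 0 := by
    by_contra! h3
    have h4 := mul_lt_mul_of_pos_right hS (mul_pos hN0 h3)
    rw [← mul_assoc N, ← sq] at h4
    exact absurd h1 (not_le.2 h4)
  rw [hT] at h2
  have hu := sq_nonneg u
  have hv := sq_nonneg v
  have ht := sq_nonneg t
  refine ⟨?_, ?_, ?_⟩ <;> refine pow_eq_zero_iff two_ne_zero |>.1 (le_antisymm ?_ (sq_nonneg _)) <;>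
    linarith

theorem outsideConic_of_polar (hd : det3 a b c ≠ 0) (hqa : q a = 0) (hqb : q b = 0)
    (hqc : q c = 0) {p : RP2}
    (h : QuadraticMap.polar q a b * QuadraticMap.polar q a c * QuadraticMap.polar q b c *
      q p.rep < 0) : OutsideConic q p := by
  set x := QuadraticMap.polar q a b with hx
  set y := QuadraticMap.polar q a c with hy
  set z := QuadraticMap.polar q b c with hz
  set α := x * y * det3 p.rep b c with hα
  set β := x * z * det3 a p.rep c with hβ
  set γ := y * z * det3 a b p.rep with hγ
  have hqp := det3_sq_mul_quadraticForm hqa hqb hqc p.rep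
  rw [← hx, ← hy, ← hz] at hqp
  have hxyz : x * y * z ≠ 0 := by
    intro h0; rw [h0, zero_mul] at h; exact lt_irrefl _ h
  have hx0 : x ≠ 0 := by rintro h0; simp [h0] at hxyz
  have hy0 : y ≠ 0 := by rintro h0; simp [h0] at hxyz
  have hz0 : z ≠ 0 := by rintro h0; simp [h0] at hxyz
  have hneg : α * β + α * γ + β * γ < 0 := by
    have e : α * β + α * γ + β * γ = det3 a b c ^ 2 * (x * y * z * q p.rep) := by
      rw [hα, hβ, hγ]; linear_combination -(x * y * z) * hqp
    rw [e]
    exact mul_neg_of_pos_of_neg (by positivity) h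
  let N := α ^ 2 + β ^ 2 + γ ^ 2
  let S := α + β + γ
  let l : (Fin 3 → ℝ) →ₗ[ℝ] ℝ :=
    ((N - S * α) * (x * y)) • det3Lin b c + ((N - S * β) * (x * z)) • det3Lin c a +
      ((N - S * γ) * (y * z)) • det3Lin a b
  have hl : ∀ w, l w = (N - S * α) * (x * y * det3 w b c) + (N - S * β) * (x * z * det3 a w c) +
      (N - S * γ) * (y * z * det3 a b w) := by
    intro w
    have e1 : det3 b c w = det3 w b c := det3_cycle w b c
    have e2 : det3 c a w = det3 a w c := by rw [← det3_cycle c a w]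
    simp only [l, LinearMap.add_apply, LinearMap.smul_apply, det3Lin_apply, smul_eq_mul, e1, e2]
    ring
  have hker : ∀ w, l w = 0 → q w = 0 → w = 0 := by
    intro w hlw hqw
    have hw := det3_sq_mul_quadraticForm hqa hqb hqc w
    rw [hqw, ← hx, ← hy, ← hz] at hw
    rw [hl] at hlw
    obtain ⟨h1, h2, h3⟩ := eq_zero_of_orthogonal (u := x * y * det3 w b c)
      (v := x * z * det3 a w c) (t := y * z * det3 a b w) hneg
      (by linear_combination -(x * y * z) * hw) (by simp only [N, S] at hlw; linear_combination hlw)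
    exact eq_zero_of_det3_eq_zero hd (by simpa [hx0, hy0] using h1) (by simpa [hx0, hz0] using h2)
      (by simpa [hy0, hz0] using h3)
  have hl0 : l ≠ 0 := by
    intro h0
    have ha : a = 0 := hker a (by rw [h0]; rfl) hqa
    apply hd
    simp [det3, ha]
  refine ⟨{p | p.rep ∈ LinearMap.ker l}, ⟨_, ?_, rfl⟩, ?_, ?_⟩
  · have := Module.Dual.finrank_ker_add_one_of_ne_zero hl0
    simp at this
    exact this
  · change l p.rep = 0
    rw [hl, ← hα, ← hβ, ← hγ]
    simp only [N, S]
    ring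
  · rw [Set.eq_empty_iff_forall_notMem]
    rintro r ⟨hr1, hr2⟩
    exact r.rep_nonzero (hker _ hr1 hr2)

theorem exists_ne_zero_of_mul_neg {W : Submodule ℝ (Fin 3 → ℝ)} {p w : Fin 3 → ℝ} (hp : p ∈ W)
    (hw : w ∈ W) (h : q w * q p < 0) : ∃ r ∈ W, r ≠ 0 ∧ q r = 0 := by
  have hqp : q p ≠ 0 := by intro h0; simp [h0] at h
  obtain ⟨t, ht⟩ := exists_quadratic_eq_zero (b := QuadraticMap.polar q p w) (c := q w) hqp
    ⟨√(discrim (q p) (QuadraticMap.polar q p w) (q w)), by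
      rw [Real.mul_self_sqrt]; unfold discrim; nlinarith [sq_nonneg (QuadraticMap.polar q p w)]⟩
  refine ⟨t • p + w, W.add_mem (W.smul_mem t hp) hw, ?_, ?_⟩
  · intro h0
    have hw' : w = (-t) • p := by rw [neg_smul]; exact eq_neg_of_add_eq_zero_right h0
    rw [hw', QuadraticMap.map_smul, smul_eq_mul] at h
    nlinarith [mul_nonneg (mul_self_nonneg t) (mul_self_nonneg (q p))]
  · rw [QuadraticMap.map_add q, QuadraticMap.map_smul, QuadraticMap.polar_smul_left, ← ht]
    simp only [smul_eq_mul]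
    ring

theorem mem_line_inter_conic {W : Submodule ℝ (Fin 3 → ℝ)} {r : Fin 3 → ℝ} (hr : r ∈ W)
    (h0 : r ≠ 0) (hq : q r = 0) : ({p : RP2 | p.rep ∈ W} ∩ ConicSet q).Nonempty := by
  obtain ⟨s, hs⟩ := Projectivization.exists_smul_eq_mk_rep ℝ r h0
  refine ⟨Projectivization.mk ℝ r h0, ?_, ?_⟩
  · change (Projectivization.mk ℝ r h0).rep ∈ W
    rw [← hs]
    exact W.smul_mem _ hr
  · change q (Projectivization.mk ℝ r h0).rep = 0
    rw [← hs, Units.smul_def, QuadraticMap.map_smul, hq, smul_zero]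

theorem not_outsideConic_of_polar (hd : det3 a b c ≠ 0) (hqa : q a = 0) (hqb : q b = 0)
    (hqc : q c = 0) {p : RP2}
    (h : 0 < QuadraticMap.polar q a b * QuadraticMap.polar q a c * QuadraticMap.polar q b c *
      q p.rep) : ¬ OutsideConic q p := by
  rintro ⟨L, ⟨W, hW, rfl⟩, hp, hL⟩
  suffices ∃ r ∈ W, r ≠ 0 ∧ q r = 0 by
    obtain ⟨r, hr, hr0, hqr⟩ := this
    exact (mem_line_inter_conic hr hr0 hqr).ne_empty hL
  have hlt : W < ⊤ := by
    rw [lt_top_iff_ne_top]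
    rintro rfl
    simp at hW
  obtain ⟨l, hl0, hl⟩ := W.exists_le_ker_of_lt_top hlt
  have hWl : W = LinearMap.ker l := by
    apply Submodule.eq_of_le_of_finrank_eq hl
    have := Module.Dual.finrank_ker_add_one_of_ne_zero hl0
    simp at this
    rw [hW]; exact this.symm
  have hmem : ∀ w, l w = 0 → w ∈ W := fun w hw => by rw [hWl]; exact hw
  have hne : a ≠ 0 ∧ b ≠ 0 ∧ c ≠ 0 := by
    refine ⟨?_, ?_, ?_⟩ <;> rintro rfl <;> exact hd (by simp [det3])
  by_cases ha : l a = 0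
  · exact ⟨a, hmem _ ha, hne.1, hqa⟩
  by_cases hb : l b = 0
  · exact ⟨b, hmem _ hb, hne.2.1, hqb⟩
  by_cases hc : l c = 0
  · exact ⟨c, hmem _ hc, hne.2.2, hqc⟩
  have hab := quadraticForm_apply_three hqa hqb hqc (l b) (-l a) 0
  have hac := quadraticForm_apply_three hqa hqb hqc (l c) 0 (-l a)
  have hbc := quadraticForm_apply_three hqa hqb hqc 0 (l c) (-l b)
  by_contra! hno
  have key : ∀ w, l w = 0 → 0 ≤ q w * q p.rep := by
    intro w hw
    by_contra! hlt
    obtain ⟨r, hr, hr0, hqr⟩ := exists_ne_zero_of_mul_neg hp (hmem w hw) hlt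
    exact hno r hr hr0 hqr
  have k1 := key (l b • a + -l a • b + (0 : ℝ) • c) (by simp; ring)
  have k2 := key (l c • a + (0 : ℝ) • b + -l a • c) (by simp; ring)
  have k3 := key ((0 : ℝ) • a + l c • b + -l b • c) (by simp; ring)
  rw [hab] at k1
  rw [hac] at k2
  rw [hbc] at k3
  have k := mul_nonneg (mul_nonneg k1 k2) k3
  have hqp : q p.rep ≠ 0 := by intro h0; simp [h0] at h
  have : 0 < (l a * l b * l c * q p.rep) ^ 2 * (QuadraticMap.polar q a b *
      QuadraticMap.polar q a c * QuadraticMap.polar q b c * q p.rep) := by positivity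
  nlinarith

end Conics

theorem det3_sq_mul_hexDet (p a b c d e : Fin 3 → ℝ) :
    det3 a b c ^ 2 * hexDet p a b c d e =
      det3 p b c * det3 a p c * (det3 a b d * det3 a b e * (det3 a b c * det3 c d e)) +
        det3 p b c * det3 a b p * (det3 a d c * det3 a e c * (det3 a b c * det3 b d e)) +
        det3 a p c * det3 a b p * (det3 d b c * det3 e b c * (det3 a b c * det3 a d e)) := by
  have h1 : ∀ x y, det3 a b c * det3 c x y =
      det3 x b c * det3 a y c - det3 a x c * det3 y b c := by
    intro x y; unfold det3; ring
  have h2 : ∀ x y, det3 a b c * det3 b x y =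
      det3 a b x * det3 y b c - det3 x b c * det3 a b y := by
    intro x y; unfold det3; ring
  have h3 : ∀ x y, det3 a b c * det3 a x y =
      det3 a x c * det3 a b y - det3 a b x * det3 a y c := by
    intro x y; unfold det3; ring
  have h4 : hexDet p a b c d e = -hexDet a b c p d e := by
    rw [hexDet_swap₂₃ a b p c d e, hexDet_swap₁₂ a p b c d e, hexDet_swap₀₁ p a b c d e]; ring
  have h5 : det3 a b c ^ 2 * hexDet p a b c d e =
      -(det3 a b d * -det3 a e c * (det3 a b c * det3 c p d) * (det3 a b c * det3 b p e) -
        -det3 a d c * det3 a b e * (det3 a b c * det3 b p d) * (det3 a b c * det3 c p e)) := by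
    rw [h4, hexDet, det3_swap_right a e c, det3_swap_right a d c]; ring
  rw [h5, h1, h1, h1, h2, h2, h2, h3]
  ring

/-- The polar values at three of the five points measure the orientation of the conic, see
`outsideConic_of_polar` and `not_outsideConic_of_polar`. -/
theorem exists_pos_polar_mul_eq {w : Fin 6 → Fin 3 → ℝ} (hw : PosOriented w)
    {q : QuadraticForm ℝ (Fin 3 → ℝ)} (hq : q ≠ 0) (h : ∀ l, l ≠ 0 → q (w l) = 0) :
    ∃ s : ℝ, 0 < s ∧
      QuadraticMap.polar q (w 1) (w 2) * QuadraticMap.polar q (w 1) (w 3) *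
        QuadraticMap.polar q (w 2) (w 3) * q (w 0) =
        s * hexDet (w 0) (w 1) (w 2) (w 3) (w 4) (w 5) := by
  have h1 := h 1 (by decide)
  have h2 := h 2 (by decide)
  have h3 := h 3 (by decide)
  have h4 := h 4 (by decide)
  have h5 := h 5 (by decide)
  have g := det3_sq_mul_quadraticForm h1 h2 h3
  have g4 := g (w 4)
  have g5 := g (w 5)
  have g0 := g (w 0)
  rw [h4, mul_zero] at g4
  rw [h5, mul_zero] at g5
  have hE := det3_sq_mul_hexDet (w 0) (w 1) (w 2) (w 3) (w 4) (w 5)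
  set x := QuadraticMap.polar q (w 1) (w 2)
  set y := QuadraticMap.polar q (w 1) (w 3)
  set z := QuadraticMap.polar q (w 2) (w 3)
  have G : 0 < det3 (w 1) (w 2) (w 3) := hw _ _ _ (by decide) (by decide)
  have pt4 : 0 < det3 (w 1) (w 2) (w 4) := hw _ _ _ (by decide) (by decide)
  have pt5 : 0 < det3 (w 1) (w 2) (w 5) := hw _ _ _ (by decide) (by decide)
  have pv4 : det3 (w 1) (w 4) (w 3) < 0 := by
    rw [det3_swap_right, neg_lt_zero]; exact hw _ _ _ (by decide) (by decide)
  have pv5 : det3 (w 1) (w 5) (w 3) < 0 := by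
    rw [det3_swap_right, neg_lt_zero]; exact hw _ _ _ (by decide) (by decide)
  have pu4 : 0 < det3 (w 4) (w 2) (w 3) := by
    rw [← det3_cycle]; exact hw _ _ _ (by decide) (by decide)
  have pu5 : 0 < det3 (w 5) (w 2) (w 3) := by
    rw [← det3_cycle]; exact hw _ _ _ (by decide) (by decide)
  have p3 : 0 < det3 (w 3) (w 4) (w 5) := hw _ _ _ (by decide) (by decide)
  have p2 : 0 < det3 (w 2) (w 4) (w 5) := hw _ _ _ (by decide) (by decide)
  have p1 : 0 < det3 (w 1) (w 4) (w 5) := hw _ _ _ (by decide) (by decide)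
  set X := det3 (w 1) (w 2) (w 4) * det3 (w 1) (w 2) (w 5) *
    (det3 (w 1) (w 2) (w 3) * det3 (w 3) (w 4) (w 5)) with hX
  set Y := det3 (w 1) (w 4) (w 3) * det3 (w 1) (w 5) (w 3) *
    (det3 (w 1) (w 2) (w 3) * det3 (w 2) (w 4) (w 5)) with hY
  set Z := det3 (w 4) (w 2) (w 3) * det3 (w 5) (w 2) (w 3) *
    (det3 (w 1) (w 2) (w 3) * det3 (w 1) (w 4) (w 5)) with hZ
  have X0 : 0 < X := by positivity
  have Y0 : 0 < Y := mul_pos (mul_pos_of_neg_of_neg pv4 pv5) (by positivity)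
  have Z0 : 0 < Z := by positivity
  have c3 : det3 (w 1) (w 2) (w 3) * det3 (w 3) (w 4) (w 5) =
      det3 (w 4) (w 2) (w 3) * det3 (w 1) (w 5) (w 3) -
        det3 (w 1) (w 4) (w 3) * det3 (w 5) (w 2) (w 3) := by unfold det3; ring
  have c2 : det3 (w 1) (w 2) (w 3) * det3 (w 2) (w 4) (w 5) =
      det3 (w 1) (w 2) (w 4) * det3 (w 5) (w 2) (w 3) -
        det3 (w 4) (w 2) (w 3) * det3 (w 1) (w 2) (w 5) := by unfold det3; ring
  have c1 : det3 (w 1) (w 2) (w 3) * det3 (w 1) (w 4) (w 5) =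
      det3 (w 1) (w 4) (w 3) * det3 (w 1) (w 2) (w 5) -
        det3 (w 1) (w 2) (w 4) * det3 (w 1) (w 5) (w 3) := by unfold det3; ring
  rw [c3] at hX
  rw [c2] at hY
  rw [c1] at hZ
  have hxy : y * X = x * Y := by
    rw [hX, hY]
    linear_combination (-(det3 (w 1) (w 5) (w 3) * det3 (w 1) (w 2) (w 5))) * g4 +
      (det3 (w 1) (w 4) (w 3) * det3 (w 1) (w 2) (w 4)) * g5
  have hxz : z * X = x * Z := by
    rw [hX, hZ]
    linear_combination (det3 (w 5) (w 2) (w 3) * det3 (w 1) (w 2) (w 5)) * g4 -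
      (det3 (w 4) (w 2) (w 3) * det3 (w 1) (w 2) (w 4)) * g5
  obtain ⟨k, hk⟩ : ∃ k, x = k * X := ⟨x / X, by field_simp⟩
  have hy : y = k * Y := by
    apply mul_right_cancel₀ X0.ne'; rw [hxy, hk]; ring
  have hz : z = k * Z := by
    apply mul_right_cancel₀ X0.ne'; rw [hxz, hk]; ring
  have hk0 : k ≠ 0 := by
    rintro rfl
    apply hq
    ext r
    have := g r
    rw [hk, hy, hz] at this
    simpa [G.ne'] using this
  have hq0 : q (w 0) = k * hexDet (w 0) (w 1) (w 2) (w 3) (w 4) (w 5) := by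
    apply mul_left_cancel₀ (pow_ne_zero 2 G.ne')
    rw [g0, mul_left_comm, hE, hk, hy, hz]
    ring
  refine ⟨k ^ 4 * (X * Y * Z), by positivity, ?_⟩
  rw [hq0, hk, hy, hz]
  ring

theorem outsideConic_iff_zero {w : Fin 6 → Fin 3 → ℝ} (hw : PosOriented w)
    {q : QuadraticForm ℝ (Fin 3 → ℝ)} (hq : q ≠ 0) (h : ∀ l, l ≠ 0 → q (w l) = 0) {p : RP2}
    {κ : ℝ} (hp : w 0 = κ • p.rep)
    (hD : hexDet (w 0) (w 1) (w 2) (w 3) (w 4) (w 5) ≠ 0) :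
    OutsideConic q p ↔ hexDet (w 0) (w 1) (w 2) (w 3) (w 4) (w 5) < 0 := by
  obtain ⟨s, hs, e⟩ := exists_pos_polar_mul_eq hw hq h
  have h1 := h 1 (by decide)
  have h2 := h 2 (by decide)
  have h3 := h 3 (by decide)
  have hd : det3 (w 1) (w 2) (w 3) ≠ 0 := (hw _ _ _ (by decide) (by decide)).ne'
  rw [show q (w 0) = κ * κ * q p.rep by rw [hp, QuadraticMap.map_smul, smul_eq_mul]] at e
  have hκ : 0 < κ * κ := by
    refine lt_of_le_of_ne (mul_self_nonneg κ) fun h0 => ?_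
    rw [← h0, zero_mul, mul_zero] at e
    exact mul_ne_zero hs.ne' hD e.symm
  rw [mul_left_comm] at e
  constructor
  · intro ho
    by_contra! hle
    have hpos : 0 < hexDet (w 0) (w 1) (w 2) (w 3) (w 4) (w 5) := lt_of_le_of_ne hle hD.symm
    refine not_outsideConic_of_polar hd h1 h2 h3 ?_ ho
    refine pos_of_mul_pos_right ?_ hκ.le
    rw [e]
    positivity
  · intro hlt
    refine outsideConic_of_polar hd h1 h2 h3 ?_
    refine neg_of_mul_neg_right ?_ hκ.le
    rw [e]
    exact mul_neg_of_pos_of_neg hs hlt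

theorem outsideConic_iff (m : Fin 6) : ∀ {w : Fin 6 → Fin 3 → ℝ} (_ : PosOriented w)
    {q : QuadraticForm ℝ (Fin 3 → ℝ)} (_ : q ≠ 0) (_ : ∀ l, l ≠ m → q (w l) = 0) {p : RP2}
    {κ : ℝ} (_ : w m = κ • p.rep) (_ : hexDet (w 0) (w 1) (w 2) (w 3) (w 4) (w 5) ≠ 0),
    OutsideConic q p ↔ (-1) ^ (m : ℕ) * hexDet (w 0) (w 1) (w 2) (w 3) (w 4) (w 5) < 0 := by
  induction m using Fin.induction with
  | zero =>
    intro w hw q hq h p κ hp hD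
    simpa using outsideConic_iff_zero hw hq h hp hD
  | succ i ih =>
    intro w hw q hq h p κ hp hD
    have hrot := hexDet_rotate (w 0) (w 1) (w 2) (w 3) (w 4) (w 5)
    have := ih (w := fun l => w (l + 1)) hw.rotate hq
      (fun l hl => h _ (by
        rw [← Fin.coeSucc_eq_succ]; exact fun e => hl (add_right_cancel e))) (p := p) (κ := κ)
      (by rw [Fin.coeSucc_eq_succ]; exact hp) (by
        change hexDet (w 1) (w 2) (w 3) (w 4) (w 5) (w 0) ≠ 0
        rw [hrot]; exact neg_ne_zero.2 hD)
    rw [this]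
    change _ * hexDet (w 1) (w 2) (w 3) (w 4) (w 5) (w 0) < 0 ↔ _
    rw [hrot, Fin.val_castSucc, Fin.val_succ, pow_succ]
    simp

/-- The alternating polynomial `hexDet` of the six vectors of `v` other than `v j`. -/
def hexMinor (v : Fin 7 → Fin 3 → ℝ) (j : Fin 7) : ℝ :=
  hexDet (v (j.succAbove 0)) (v (j.succAbove 1)) (v (j.succAbove 2)) (v (j.succAbove 3))
    (v (j.succAbove 4)) (v (j.succAbove 5))

theorem hexMinor_neg_rev (v : Fin 7 → Fin 3 → ℝ) (j : Fin 7) :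
    hexMinor (fun i => -v i.rev) j = -hexMinor v j.rev := by
  simp only [hexMinor, hexDet_neg, Fin.rev_succAbove]
  exact hexDet_reverse _ _ _ _ _ _

/-- `v` consists of representatives of the points of `f`. -/
def Represents {n : ℕ} (v : Fin n → Fin 3 → ℝ) (f : Fin n → RP2) : Prop :=
  ∀ i, ∃ κ : ℝ, κ ≠ 0 ∧ v i = κ • (f i).rep

theorem Represents.eq_zero_iff {n : ℕ} {v : Fin n → Fin 3 → ℝ} {f : Fin n → RP2}
    (h : Represents v f) (q : QuadraticForm ℝ (Fin 3 → ℝ)) (i : Fin n) :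
    q (v i) = 0 ↔ q (f i).rep = 0 := by
  obtain ⟨κ, hκ, e⟩ := h i
  rw [e, QuadraticMap.map_smul]
  simp [hκ]

theorem hexMinor_ne_zero {v : Fin 7 → Fin 3 → ℝ} (hv : PosOriented v) {f : Fin 7 → RP2}
    (hf : TypicalCfg f) (hvf : Represents v f) (j : Fin 7) : hexMinor v j ≠ 0 := by
  intro h0
  let u : Fin 5 → Fin 3 → ℝ := (v ∘ j.succAbove) ∘ Fin.castSucc
  have hu : PosOriented u := (hv.comp (Fin.strictMono_succAbove j)).comp Fin.strictMono_castSucc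
  refine hf.2 j.succAbove Fin.succAbove_right_injective ⟨_, hexForm_ne_zero hu, ?_⟩
  rintro _ ⟨l, rfl⟩
  refine (hvf.eq_zero_iff _ _).1 ?_
  induction l using Fin.lastCases with
  | last => rw [hexForm_apply]; exact h0
  | cast i => exact hexForm_apply_eq_zero u i

theorem outAll_iff {v : Fin 7 → Fin 3 → ℝ} (hv : PosOriented v) {f : Fin 7 → RP2}
    (hvf : Represents v f) {j : Fin 7} (hD : hexMinor v j ≠ 0) (m : Fin 6) :
    OutAll f (j.succAbove m) j ↔ (-1) ^ (m : ℕ) * hexMinor v j < 0 := by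
  have hw : PosOriented (v ∘ j.succAbove) := hv.comp (Fin.strictMono_succAbove j)
  obtain ⟨κ, -, hκ⟩ := hvf (j.succAbove m)
  have key : ∀ q : QuadraticForm ℝ (Fin 3 → ℝ), q ≠ 0 →
      (∀ l, l ≠ m → q (v (j.succAbove l)) = 0) →
      (OutsideConic q (f (j.succAbove m)) ↔ (-1) ^ (m : ℕ) * hexMinor v j < 0) :=
    fun q hq hl => outsideConic_iff m hw hq hl hκ hD
  constructor
  · intro h
    let u : Fin 5 → Fin 3 → ℝ := (v ∘ j.succAbove) ∘ m.succAbove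
    have hu : PosOriented u := hw.comp (Fin.strictMono_succAbove m)
    have hz : ∀ l, l ≠ m → hexForm (u 0) (u 1) (u 2) (u 3) (u 4) (v (j.succAbove l)) = 0 := by
      intro l hl
      obtain ⟨i, rfl⟩ := Fin.exists_succAbove_eq hl
      exact hexForm_apply_eq_zero u i
    refine (key _ (hexForm_ne_zero hu) hz).1 (h _ (hexForm_ne_zero hu) fun k hk hkj => ?_)
    obtain ⟨l, rfl⟩ := Fin.exists_succAbove_eq hkj
    exact (hvf.eq_zero_iff _ _).1 (hz l fun h => hk (by rw [h]))
  · intro h q hq hq0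
    refine (key q hq fun l hl => ?_).2 h
    exact (hvf.eq_zero_iff _ _).2
      (hq0 _ (fun h => hl (Fin.succAbove_right_injective h)) (Fin.succAbove_ne j l))

theorem domIdx_eq {v : Fin 7 → Fin 3 → ℝ} (hv : PosOriented v) {f : Fin 7 → RP2}
    (hvf : Represents v f) (hD : ∀ j, hexMinor v j < 0) (k : Fin 7) :
    domIdx f k = ![6, 1, 4, 3, 2, 5, 0] k := by
  let c : Fin 7 → Fin 7 → ℕ := fun k j => if k < j then (k + 1 : ℕ) % 2 else k % 2
  have hc : ∀ (j : Fin 7) (m : Fin 6), (if Even (m : ℕ) then 1 else 0) = c (j.succAbove m) j := by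
    decide
  have hd : ∀ j, j ≠ k → dIdx f k j = c k j := by
    intro j hj
    obtain ⟨m, rfl⟩ := Fin.exists_succAbove_eq hj.symm
    rw [← hc, dIdx, outAll_iff hv hvf (hD j).ne]
    congr 1
    rw [eq_iff_iff]
    rcases Nat.even_or_odd (m : ℕ) with h | h
    · simp [h, h.neg_one_pow, hD j]
    · simp [h.neg_one_pow, Nat.not_even_iff_odd.2 h, (hD j).le]
  rw [domIdx, Finset.sum_congr rfl fun j hj => hd j (Finset.ne_of_mem_erase hj)]
  clear hd hc
  revert k
  decide

theorem mul_pos_of_mul_eq_add {A B C x y z : ℝ} (hA : 0 < A) (hB : 0 < B) (hC : 0 < C)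
    (h : A * x = B * y + C * z) (hyz : 0 < y * z) : 0 < x * y := by
  have hy : y ≠ 0 := by rintro rfl; simp at hyz
  have e : A * (x * y) = B * y ^ 2 + C * (y * z) := by linear_combination y * h
  refine pos_of_mul_pos_right ?_ hA.le
  rw [e]
  positivity

theorem hexDet_move (a b c d x y : Fin 3 → ℝ) :
    hexDet a b c d x y = hexDet x a b c d y := by
  conv_rhs => rw [hexDet_swap₀₁, hexDet_swap₁₂, hexDet_swap₂₃, hexDet_swap₃₄]
  ring

theorem hexMinor_mul_pos {v : Fin 7 → Fin 3 → ℝ} (hv : PosOriented v)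
    (h : 0 < hexMinor v 0 * hexMinor v 6) (j : Fin 7) : 0 < hexMinor v j * hexMinor v 0 := by
  have h0 : hexMinor v 0 = hexDet (v 1) (v 2) (v 3) (v 4) (v 5) (v 6) := rfl
  have h6 : hexMinor v 6 = hexDet (v 0) (v 1) (v 2) (v 3) (v 4) (v 5) := rfl
  have pos : ∀ a b c d e f : Fin 7, a < b → b < c → d < e → e < f →
      0 < det3 (v a) (v b) (v c) * det3 (v d) (v e) (v f) :=
    fun a b c d e f h1 h2 h3 h4 => mul_pos (hv _ _ _ h1 h2) (hv _ _ _ h3 h4)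
  have key : ∀ (a b c d j : Fin 7), 0 < a → a < b → b < c → c < d → d < 6 → ∀ s A : ℝ,
      det3 (v a) (v b) (v j) * det3 (v c) (v d) (v j) = s * A → s * s = 1 → 0 < A →
      hexDet (v a) (v b) (v c) (v d) (v j) (v 6) = s * hexMinor v 0 →
      hexDet (v 0) (v a) (v b) (v c) (v d) (v j) = s * hexMinor v 6 →
      hexDet (v 0) (v a) (v b) (v c) (v d) (v 6) = hexMinor v j →
      0 < hexMinor v j * hexMinor v 0 := by
    intro a b c d j ha hab hbc hcd hd s A hA hs hA0 e0 e6 ej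
    have hrel := hexDet_relation (v a) (v b) (v c) (v d) (v 0) (v j) (v 6)
    rw [hexDet_move _ _ _ _ (v 0), hexDet_move _ _ _ _ (v 0), e0, e6, ej, hA] at hrel
    refine mul_pos_of_mul_eq_add hA0
      (pos 0 a b 0 c d ha hab (ha.trans (hab.trans hbc)) hcd)
      (pos a b 6 c d 6 hab (hbc.trans (hcd.trans hd)) hcd hd) ?_ h
    rw [← det3_cycle (v 0) (v a), ← det3_cycle (v 0) (v c)]
    linear_combination (-s) * hrel +
      (det3 (v a) (v b) (v 0) * det3 (v c) (v d) (v 0) * hexMinor v 0 +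
        det3 (v a) (v b) (v 6) * det3 (v c) (v d) (v 6) * hexMinor v 6 - A * hexMinor v j) * hs
  fin_cases j
  · have : hexMinor v 0 ≠ 0 := by intro h0; simp [h0] at h
    exact mul_self_pos.2 this
  · refine key 2 3 4 5 1 (by decide) (by decide) (by decide) (by decide) (by decide) 1
      (det3 (v 1) (v 2) (v 3) * det3 (v 1) (v 4) (v 5)) ?_ (by norm_num)
      (pos _ _ _ _ _ _ (by decide) (by decide) (by decide) (by decide)) ?_ ?_ rfl
    · rw [det3_cycle (v 1) (v 2) (v 3), det3_cycle (v 1) (v 4) (v 5)]; ring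
    · rw [hexDet_move, h0]; ring
    · rw [h6, hexDet_swap₄₅, hexDet_swap₃₄, hexDet_swap₂₃, hexDet_swap₁₂]; ring
  · refine key 1 3 4 5 2 (by decide) (by decide) (by decide) (by decide) (by decide) (-1)
      (det3 (v 1) (v 2) (v 3) * det3 (v 2) (v 4) (v 5)) ?_ (by norm_num)
      (pos _ _ _ _ _ _ (by decide) (by decide) (by decide) (by decide)) ?_ ?_ rfl
    · rw [det3_swap_right (v 1) (v 2) (v 3), det3_cycle (v 2) (v 4) (v 5)]; ring
    · rw [hexDet_move, h0, hexDet_swap₀₁]; ring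
    · rw [h6, hexDet_swap₄₅, hexDet_swap₃₄, hexDet_swap₂₃]; ring
  · refine key 1 2 4 5 3 (by decide) (by decide) (by decide) (by decide) (by decide) 1
      (det3 (v 1) (v 2) (v 3) * det3 (v 3) (v 4) (v 5)) ?_ (by norm_num)
      (pos _ _ _ _ _ _ (by decide) (by decide) (by decide) (by decide)) ?_ ?_ rfl
    · rw [det3_cycle (v 3) (v 4) (v 5)]; ring
    · rw [h0, hexDet_swap₃₄, hexDet_swap₂₃]; ring
    · rw [h6, hexDet_swap₄₅, hexDet_swap₃₄]; ring
  · refine key 1 2 3 5 4 (by decide) (by decide) (by decide) (by decide) (by decide) (-1)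
      (det3 (v 1) (v 2) (v 4) * det3 (v 3) (v 4) (v 5)) ?_ (by norm_num)
      (pos _ _ _ _ _ _ (by decide) (by decide) (by decide) (by decide)) ?_ ?_ rfl
    · rw [det3_swap_right (v 3)]; ring
    · rw [h0, hexDet_swap₃₄]; ring
    · rw [h6, hexDet_swap₄₅]; ring
  · refine key 1 2 3 4 5 (by decide) (by decide) (by decide) (by decide) (by decide) 1
      (det3 (v 1) (v 2) (v 5) * det3 (v 3) (v 4) (v 5)) ?_ (by norm_num)
      (pos _ _ _ _ _ _ (by decide) (by decide) (by decide) (by decide)) ?_ ?_ rfl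
    · ring
    · rw [h0]; ring
    · rw [h6]; ring
  · rw [mul_comm]; exact h

theorem exists_rotation {v : Fin 7 → Fin 3 → ℝ} (hD : ∀ j, hexMinor v j ≠ 0) :
    ∃ r : Fin 7, 0 < hexMinor (fun i => v (i + r)) 0 * hexMinor (fun i => v (i + r)) 6 := by
  by_contra! h
  have r1 := hexDet_rotate
  have r2 : ∀ a b c d e f, hexDet c d e f a b = hexDet a b c d e f := by
    intro a b c d e f; rw [r1 b c d e f a, r1, neg_neg]
  have r3 : ∀ a b c d e f, hexDet d e f a b c = -hexDet a b c d e f := by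
    intro a b c d e f; rw [r1 c d e f a b, r2]
  have r4 : ∀ a b c d e f, hexDet e f a b c d = hexDet a b c d e f := by
    intro a b c d e f; rw [r2 c d e f a b, r2]
  have r5 : ∀ a b c d e f, hexDet f a b c d e = -hexDet a b c d e f := by
    intro a b c d e f; rw [r3 c d e f a b, r2]
  have h0 : hexMinor v 0 * hexMinor v 6 ≤ 0 := h 0
  have step : ∀ {x y x' y' : ℝ}, x * y ≤ 0 → x = -x' → y = y' → x' ≠ 0 → y' ≠ 0 →
      0 < y' * x' := by
    rintro x y x' y' h rfl rfl hx hy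
    refine lt_of_le_of_ne (by linarith) (mul_ne_zero hy hx).symm
  have step' : ∀ {x y x' y' : ℝ}, x * y ≤ 0 → x = x' → y = -y' → x' ≠ 0 → y' ≠ 0 →
      0 < y' * x' := by
    rintro x y x' y' h rfl rfl hx hy
    refine lt_of_le_of_ne (by linarith) (mul_ne_zero hy hx).symm
  have h1 : 0 < hexMinor v 0 * hexMinor v 1 :=
    step (h 1) (r1 (v 0) (v 2) (v 3) (v 4) (v 5) (v 6)) rfl (hD 1) (hD 0)
  have h2 : 0 < hexMinor v 1 * hexMinor v 2 :=
    step' (h 2) (r2 (v 0) (v 1) (v 3) (v 4) (v 5) (v 6)) (r1 (v 0) (v 2) (v 3) (v 4) (v 5) (v 6))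
      (hD 2) (hD 1)
  have h3 : 0 < hexMinor v 2 * hexMinor v 3 :=
    step (h 3) (r3 (v 0) (v 1) (v 2) (v 4) (v 5) (v 6)) (r2 (v 0) (v 1) (v 3) (v 4) (v 5) (v 6))
      (hD 3) (hD 2)
  have h4 : 0 < hexMinor v 3 * hexMinor v 4 :=
    step' (h 4) (r4 (v 0) (v 1) (v 2) (v 3) (v 5) (v 6)) (r3 (v 0) (v 1) (v 2) (v 4) (v 5) (v 6))
      (hD 4) (hD 3)
  have h5 : 0 < hexMinor v 4 * hexMinor v 5 :=
    step (h 5) (r5 (v 0) (v 1) (v 2) (v 3) (v 4) (v 6)) (r4 (v 0) (v 1) (v 2) (v 3) (v 5) (v 6))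
      (hD 5) (hD 4)
  have h6 : 0 < hexMinor v 5 * hexMinor v 6 :=
    step' (h 6) rfl (r5 (v 0) (v 1) (v 2) (v 3) (v 4) (v 6)) (hD 6) (hD 5)
  have trans : ∀ {x y z : ℝ}, 0 < x * y → 0 < y * z → 0 < x * z := by
    intro x y z hxy hyz
    have : 0 < (y * y) * (x * z) := by nlinarith [mul_pos hxy hyz]
    exact pos_of_mul_pos_right this (mul_self_nonneg y)
  exact not_lt.2 h0 (trans h1 (trans h2 (trans h3 (trans h4 (trans h5 h6)))))

theorem PosOriented.rotate_by {v : Fin 7 → Fin 3 → ℝ} (hv : PosOriented v) (r : Fin 7) :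
    PosOriented (fun i => v (i + r)) := by
  induction r using Fin.induction with
  | zero => simpa using hv
  | succ r ih =>
    have := ih.rotate
    simpa only [← Fin.coeSucc_eq_succ, add_assoc, add_comm (1 : Fin 7)] using this

theorem ConvexPosWith.comp {n : ℕ} {φ : (Fin 3 → ℝ) →ₗ[ℝ] ℝ} {f : Fin n → RP2}
    (h : ConvexPosWith φ f) (σ : Equiv.Perm (Fin n)) : ConvexPosWith φ (f ∘ σ) := by
  refine ⟨h.1, fun i => h.2.1 _, fun i => ?_⟩
  have e : (f ∘ σ) '' {j | j ≠ i} = f '' {j | j ≠ σ i} := by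
    rw [Set.image_comp]
    congr 1
    ext k
    simp only [Set.mem_image, Set.mem_ofPred_eq]
    constructor
    · rintro ⟨j, hj, rfl⟩
      exact fun h => hj (σ.injective h)
    · intro hk
      exact ⟨σ.symm k, fun h => hk (by rw [← h, σ.apply_symm_apply]), σ.apply_symm_apply k⟩
  rw [e]
  exact h.2.2 (σ i)

theorem ConsecWith.rotate {n : ℕ} [NeZero n] {φ : (Fin 3 → ℝ) →ₗ[ℝ] ℝ} {f : Fin n → RP2}
    (h : ConsecWith φ f) (r : Fin n) : ConsecWith φ (f ∘ Equiv.addRight r) := by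
  refine ⟨h.1.comp _, fun i => ?_⟩
  obtain ⟨ψ, h1, h2⟩ := h.2 (i + r)
  refine ⟨ψ, ?_, fun j hj hj' => h2 _ (fun h => hj (add_right_cancel h)) fun h => hj' ?_⟩
  · simp only [Function.comp_apply, Equiv.coe_addRight, h1, add_right_comm]
  · rw [add_right_comm] at h
    exact add_right_cancel h

theorem ConsecWith.rev {φ : (Fin 3 → ℝ) →ₗ[ℝ] ℝ} {f : Fin 7 → RP2}
    (h : ConsecWith φ f) : ConsecWith φ (f ∘ Fin.revPerm) := by
  refine ⟨h.1.comp _, fun i => ?_⟩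
  have hi : Fin.rev (i + 1) + 1 = Fin.rev i := by revert i; decide
  obtain ⟨ψ, h1, h2⟩ := h.2 (Fin.rev (i + 1))
  rw [hi] at h1 h2
  refine ⟨ψ, h1.symm, fun j hj hj' => ?_⟩
  have := h2 (Fin.rev j) (fun h => hj' (Fin.rev_injective h)) fun h => hj (Fin.rev_injective h)
  rw [h1] at this
  exact this

theorem ConvexPosWith.consecWith {n : ℕ} {φ : (Fin 3 → ℝ) →ₗ[ℝ] ℝ} {f : Fin (n + 1) → RP2}
    (h : ConvexPosWith φ f) (hv : PosOriented fun i => chart φ (f i)) : ConsecWith φ f := by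
  refine ⟨h, fun i => ⟨-det3Lin (chart φ (f i)) (chart φ (f (i + 1))), ?_, fun j hj hj' => ?_⟩⟩
  · simp only [LinearMap.neg_apply, det3Lin_apply]
    unfold det3
    ring
  · have e : det3 (chart φ (f i)) (chart φ (f (i + 1))) (chart φ (f i)) = 0 := by
      unfold det3; ring
    simp only [LinearMap.neg_apply, det3Lin_apply, e, neg_lt_neg_iff]
    by_cases hi : i = Fin.last n
    · subst hi
      rw [Fin.last_add_one] at hj' ⊢
      rw [← det3_cycle]
      exact hv _ _ _ (Fin.pos_of_ne_zero hj') (lt_of_le_of_ne (Fin.le_last j) hj)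
    · have hi' : i < i + 1 := Fin.lt_add_one_iff.2 (lt_of_le_of_ne (Fin.le_last i) hi)
      rcases lt_or_gt_of_ne hj with hlt | hgt
      · rw [det3_cycle]
        exact hv _ _ _ hlt hi'
      · exact hv _ _ _ hi' (lt_of_le_of_ne (Fin.add_one_le_of_lt hgt) hj'.symm)

theorem ConvexPosWith.exists_supporting {n : ℕ} {φ : (Fin 3 → ℝ) →ₗ[ℝ] ℝ} {f : Fin n → RP2}
    (h : ConvexPosWith φ f) (i : Fin n) : ∃ θ : (Fin 3 → ℝ) →ₗ[ℝ] ℝ,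
      θ (chart φ (f i)) = 0 ∧ ∀ j, j ≠ i → 0 < θ (chart φ (f j)) := by
  have hφ : ∀ j, φ (chart φ (f j)) = 1 := fun j => by
    rw [chart, map_smul, smul_eq_mul, inv_mul_cancel₀ (h.2.1 j)]
  obtain ⟨F, u, h1, h2⟩ := geometric_hahn_banach_point_closed (convex_convexHull ℝ _)
    (((Set.toFinite _).isCompact_convexHull ℝ).isClosed) (h.2.2 i)
  refine ⟨F.toLinearMap - F (chart φ (f i)) • φ, ?_, fun j hj => ?_⟩
  · simp [hφ]
  · have := h2 _ (subset_convexHull ℝ _ ⟨f j, ⟨j, hj, rfl⟩, rfl⟩)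
    simp only [LinearMap.sub_apply, LinearMap.smul_apply, hφ, smul_eq_mul, mul_one,
      ContinuousLinearMap.coe_coe]
    linarith

theorem ConvexPosWith.exists_perm_posOriented {φ : (Fin 3 → ℝ) →ₗ[ℝ] ℝ} {f : Fin 7 → RP2}
    (h : ConvexPosWith φ f) (hf : SimpleCfg f) :
    ∃ σ : Equiv.Perm (Fin 7), PosOriented fun i => chart φ (f (σ i)) := by
  classical
  set v : Fin 7 → Fin 3 → ℝ := fun i => chart φ (f i) with hv
  have hne : ∀ i j k, i ≠ j → i ≠ k → j ≠ k → det3 (v i) (v j) (v k) ≠ 0 := by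
    intro i j k hij hik hjk
    have hd := det3_ne_zero_of_linearIndependent (not_not.1 (hf.2 i j k hij hik hjk))
    have hφ := h.2.1
    simp only [hv, chart, det3_smul]
    exact mul_ne_zero (mul_ne_zero (mul_ne_zero (inv_ne_zero (hφ i)) (inv_ne_zero (hφ j)))
      (inv_ne_zero (hφ k))) hd
  obtain ⟨θ, hθ0, hθ⟩ := h.exists_supporting 0
  let slope : Fin 7 → ℝ := fun j => det3 (v 0) (v 1) (v j) / θ (v j)
  let g : Fin 7 → WithBot ℝ := fun j => if j = 0 then ⊥ else (slope j : WithBot ℝ)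
  let σ := Tuple.sort g
  have hmono : Monotone (g ∘ σ) := Tuple.monotone_sort g
  have hσ0 : ∀ {i j}, i < j → σ j ≠ 0 := by
    intro i j hij hj
    have h1 := hmono hij.le
    simp only [Function.comp_apply, g, hj, if_true, le_bot_iff] at h1
    by_cases hi : σ i = 0
    · exact hij.ne (σ.injective (hi.trans hj.symm))
    · simp [hi] at h1
  have hσ : σ 0 = 0 := by
    obtain ⟨k, hk⟩ := σ.surjective 0
    rcases eq_or_ne k 0 with rfl | hk0
    · exact hk
    · exact absurd hk (hσ0 (Fin.pos_of_ne_zero hk0))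
  have hpos : ∀ {i j}, 0 < i → i < j → 0 < det3 (v 0) (v (σ i)) (v (σ j)) := by
    intro i j hi hij
    have hi0 := hσ0 hi
    have hj0 := hσ0 hij
    have h1 := hmono hij.le
    simp only [Function.comp_apply, g, hi0, hj0, if_false, WithBot.coe_le_coe, slope] at h1
    rw [div_le_div_iff₀ (hθ _ hi0) (hθ _ hj0)] at h1
    have e := congrArg θ (det3_cramer (v 0) (v (σ i)) (v (σ j)) (v 1))
    simp only [map_add, map_smul, smul_eq_mul] at e
    rw [show θ (v 0) = 0 from hθ0, det3_swap_right (v 0) (v 1) (v (σ i))] at e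
    refine lt_of_le_of_ne ?_ (hne _ _ _ hi0.symm hj0.symm (σ.injective.ne hij.ne)).symm
    refine nonneg_of_mul_nonneg_left (b := θ (v 1)) ?_ (hθ 1 (by decide))
    rw [e]
    change det3 (v 0) (v 1) (v (σ i)) * θ (v (σ j)) ≤ det3 (v 0) (v 1) (v (σ j)) * θ (v (σ i)) at h1
    linarith
  refine ⟨σ, fun i j k hij hjk => ?_⟩
  change 0 < det3 (v (σ i)) (v (σ j)) (v (σ k))
  rcases eq_or_ne i 0 with rfl | hi
  · rw [hσ]
    exact hpos hij hjk
  have hi := Fin.pos_of_ne_zero hi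
  have hik := hij.trans hjk
  by_contra! hle
  have hlt : det3 (v (σ i)) (v (σ j)) (v (σ k)) < 0 := lt_of_le_of_ne hle
    (hne _ _ _ (σ.injective.ne hij.ne) (σ.injective.ne hik.ne) (σ.injective.ne hjk.ne))
  obtain ⟨η, hη0, hη⟩ := h.exists_supporting (σ j)
  have e := congrArg η (det3_cramer (v 0) (v (σ i)) (v (σ k)) (v (σ j)))
  simp only [map_add, map_smul, smul_eq_mul] at e
  rw [show η (v (σ j)) = 0 from hη0, mul_zero, det3_swap] at e
  have t1 := mul_pos (neg_pos.2 hlt) (hη 0 (hσ0 hij).symm)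
  have t2 := mul_pos (hpos (hi.trans hij) hjk) (hη _ (σ.injective.ne hij.ne))
  have t3 := mul_pos (hpos hi hij) (hη _ (σ.injective.ne hjk.ne'))
  change 0 < _ * η (v 0) at t1
  change 0 < _ * η (v (σ i)) at t2
  change 0 < _ * η (v (σ k)) at t3
  linarith

/-- Every heptagonal typical 7-configuration admits a canonical cyclic numeration, i.e. a
numeration of its points, consecutive for the cyclic order of the convex position, whose
sequence of dominance indices is `6, 1, 4, 3, 2, 5, 0`. -/
theorem canonical_cyclic_numeration (f : Fin 7 → RP2)
    (hf : TypicalCfg f) (hconv : ConvexPos f) :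
    ∃ σ : Equiv.Perm (Fin 7), ConsecConvexPos (f ∘ σ) ∧
      ∀ k : Fin 7, domIdx (f ∘ σ) k = ![6, 1, 4, 3, 2, 5, 0] k := by
  obtain ⟨φ, hφ⟩ := hconv
  obtain ⟨σ, hσ⟩ := hφ.exists_perm_posOriented hf.1
  have hcons : ConsecWith φ (f ∘ σ) := (hφ.comp σ).consecWith hσ
  set v : Fin 7 → Fin 3 → ℝ := fun i => chart φ (f (σ i)) with hv
  have hrep : Represents v (f ∘ σ) := fun i => ⟨_, inv_ne_zero (hφ.2.1 (σ i)), rfl⟩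
  have htyp : TypicalCfg (f ∘ σ) :=
    ⟨⟨hf.1.1.comp σ.injective, fun i j k hij hik hjk =>
      hf.1.2 _ _ _ (σ.injective.ne hij) (σ.injective.ne hik) (σ.injective.ne hjk)⟩,
      fun g hg => hf.2 (σ ∘ g) (σ.injective.comp hg)⟩
  obtain ⟨r, hr⟩ := exists_rotation (hexMinor_ne_zero hσ htyp hrep)
  set w : Fin 7 → Fin 3 → ℝ := fun i => v (i + r) with hw
  have hwpos : PosOriented w := hσ.rotate_by r
  have hall := hexMinor_mul_pos hwpos hr
  have hwrep : Represents w (f ∘ σ ∘ Equiv.addRight r) := fun i => hrep (i + r)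
  have hwcons : ConsecWith φ (f ∘ σ ∘ Equiv.addRight r) := hcons.rotate r
  rcases lt_or_ge (hexMinor w 0) 0 with h0 | h0
  · exact ⟨(Equiv.addRight r).trans σ, ⟨φ, hwcons⟩,
      domIdx_eq hwpos hwrep fun j => neg_of_mul_pos_left (hall j) h0.le⟩
  · refine ⟨Fin.revPerm.trans ((Equiv.addRight r).trans σ), ⟨φ, hwcons.rev⟩,
      domIdx_eq hwpos.neg_rev (fun i => ?_) fun j => ?_⟩
    · obtain ⟨κ, hκ, e⟩ := hwrep i.rev
      exact ⟨-κ, neg_ne_zero.2 hκ, by change -w i.rev = _; rw [e, neg_smul]; rfl⟩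
    · rw [hexMinor_neg_rev, neg_lt_zero]
      exact pos_of_mul_pos_left (hall j.rev) h0

end
end
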